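/- Let T be the spectrum of a discrete valuation ring with closed point 0, f : X -> T a flat morphism of finite type with S2 fibers, and Z0 a 0-dimensional closed subscheme of the special fiber X0 with depth_{Z0} X0 >= 2. Set U = X \ Z0 and U0 = X0 \ Z0 with open immersions j : U -> X and j0 : U0 -> X0, and let L_U be a line bundle on U. Then j_* L_U is a locally free O_X-module if and only if (j0)_* (L_U|_{U0}) is a locally free O_{X0}-module and j_* (L_U^{tensor r}) is a locally free O_X-module for some integer r > 0. -/

import Mathlib

open AlgebraicGeometry CategoryTheory Opposite TopologicalSpace

universe u

namespace LocalPic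

/-- Restriction of invertible sections along an inclusion of opens. -/
def resU (X : Scheme.{u}) {U V : X.Opens} (h : V ≤ U) :
    (Γ(X, U))ˣ →* (Γ(X, V))ˣ :=
  Units.map (X.presheaf.map (homOfLE h).op).hom.toMonoidHom

/-- Restriction of sections along an inclusion of opens. -/
def resS (X : Scheme.{u}) {U V : X.Opens} (h : V ≤ U) : ↥Γ(X, U) →+* ↥Γ(X, V) :=
  (X.presheaf.map (homOfLE h).op).hom

lemma resU_resU (X : Scheme.{u}) {U V W : X.Opens} (h1 : W ≤ V) (h2 : V ≤ U)
    (u : (Γ(X, U))ˣ) :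
    resU X h1 (resU X h2 u) = resU X (h1.trans h2) u := by
  ext
  show (X.presheaf.map (homOfLE h1).op) ((X.presheaf.map (homOfLE h2).op) u) = _
  rw [← CategoryTheory.comp_apply, ← Functor.map_comp, ← op_comp, homOfLE_comp]
  rfl

/-- A line bundle on the open subset `V` of a scheme `X`, presented by a Čech 1-cocycle
of invertible sections with respect to an open cover of `V`. -/
structure LineBundleOn (X : Scheme.{u}) (V : X.Opens) : Type (u + 1) where
  ι : Type u
  U : ι → X.Opens
  le : ∀ i, U i ≤ V
  covers : ∀ x ∈ V, ∃ i, x ∈ U i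
  t : ∀ i j, (Γ(X, U i ⊓ U j))ˣ
  cocycle : ∀ i j k,
    resU X (inf_le_left : U i ⊓ U j ⊓ U k ≤ U i ⊓ U j) (t i j) *
      resU X (le_inf (inf_le_left.trans inf_le_right) inf_le_right :
        U i ⊓ U j ⊓ U k ≤ U j ⊓ U k) (t j k) =
    resU X (le_inf (inf_le_left.trans inf_le_left) inf_le_right :
        U i ⊓ U j ⊓ U k ≤ U i ⊓ U k) (t i k)

namespace LineBundleOn

variable {X Y : Scheme.{u}} {V : X.Opens}

lemma cocycle_res (L : LineBundleOn X V) (i j k : L.ι) {W : X.Opens}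
    (h : W ≤ L.U i ⊓ L.U j ⊓ L.U k)
    (h1 : W ≤ L.U i ⊓ L.U j) (h2 : W ≤ L.U j ⊓ L.U k) (h3 : W ≤ L.U i ⊓ L.U k) :
    resU X h1 (L.t i j) * resU X h2 (L.t j k) = resU X h3 (L.t i k) := by
  have e := congrArg (resU X h) (L.cocycle i j k)
  rw [map_mul, resU_resU, resU_resU, resU_resU] at e
  exact e

/-- Tensor powers of a line bundle. -/
def pow (L : LineBundleOn X V) (n : ℕ) : LineBundleOn X V where
  ι := L.ι
  U := L.U
  le := L.le
  covers := L.covers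
  t i j := (L.t i j) ^ n
  cocycle i j k := by rw [map_pow, map_pow, map_pow, ← mul_pow, L.cocycle]

/-- The inverse (dual) of a line bundle. -/
def inv (L : LineBundleOn X V) : LineBundleOn X V where
  ι := L.ι
  U := L.U
  le := L.le
  covers := L.covers
  t i j := (L.t i j)⁻¹
  cocycle i j k := by rw [map_inv, map_inv, map_inv, ← mul_inv, L.cocycle]

/-- A line bundle is trivial if its cocycle is a coboundary, i.e. if it admits a
nowhere vanishing global section. -/
def IsTrivial (L : LineBundleOn X V) : Prop :=
  ∃ s : ∀ i, (Γ(X, L.U i))ˣ, ∀ i j,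
    L.t i j = resU X inf_le_left (s i) * (resU X inf_le_right (s j))⁻¹

/-- A line bundle is torsion if some positive tensor power of it is trivial. -/
def IsTorsion (L : LineBundleOn X V) : Prop :=
  ∃ n : ℕ, 0 < n ∧ IsTrivial (L.pow n)

def preimage_inf_le (f : Y ⟶ X) (A B : X.Opens) :
    f ⁻¹ᵁ A ⊓ f ⁻¹ᵁ B ≤ f ⁻¹ᵁ (A ⊓ B) := by
  intro x hx
  have hx' : x ∈ (↑(f ⁻¹ᵁ A ⊓ f ⁻¹ᵁ B) : Set Y) := hx
  rw [Opens.coe_inf] at hx'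
  exact ⟨hx'.1, hx'.2⟩

/-- Mapping invertible sections along the pull-back of sections of a morphism. -/
def mapU (f : Y ⟶ X) {U : X.Opens} {W : Y.Opens} (e : W ≤ f ⁻¹ᵁ U) :
    (Γ(X, U))ˣ →* (Γ(Y, W))ˣ :=
  Units.map (f.appLE U W e).hom.toMonoidHom

lemma resU_mapU (f : Y ⟶ X) {U : X.Opens} {W W' : Y.Opens} (e : W ≤ f ⁻¹ᵁ U)
    (h : W' ≤ W) (u : (Γ(X, U))ˣ) :
    resU Y h (mapU f e u) = mapU f (h.trans e) u := by
  ext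
  show (Y.presheaf.map (homOfLE h).op) ((f.appLE U W e) u) = (f.appLE U W' _) u
  rw [← CategoryTheory.comp_apply, Scheme.Hom.appLE_map]

lemma mapU_resU (f : Y ⟶ X) {U U' : X.Opens} {W : Y.Opens} (hU : U' ≤ U)
    (e : W ≤ f ⁻¹ᵁ U') (e' : W ≤ f ⁻¹ᵁ U) (u : (Γ(X, U))ˣ) :
    mapU f e (resU X hU u) = mapU f e' u := by
  ext
  show (f.appLE U' W e) ((X.presheaf.map (homOfLE hU).op) u) = (f.appLE U W e') u
  rw [← CategoryTheory.comp_apply, Scheme.Hom.map_appLE]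

/-- Pullback of a line bundle along a morphism of schemes. -/
def pullback (f : Y ⟶ X) (L : LineBundleOn X V) : LineBundleOn Y (f ⁻¹ᵁ V) where
  ι := L.ι
  U i := f ⁻¹ᵁ L.U i
  le i x hx := L.le i hx
  covers x hx := by
    obtain ⟨i, hi⟩ := L.covers (f.base x) hx
    exact ⟨i, hi⟩
  t i j := mapU f (preimage_inf_le f (L.U i) (L.U j)) (L.t i j)
  cocycle i j k := by
    rw [resU_mapU, resU_mapU, resU_mapU,
        ← mapU_resU f (inf_le_left : L.U i ⊓ L.U j ⊓ L.U k ≤ L.U i ⊓ L.U j),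
        ← mapU_resU f (le_inf (inf_le_left.trans inf_le_right) inf_le_right :
          L.U i ⊓ L.U j ⊓ L.U k ≤ L.U j ⊓ L.U k),
        ← mapU_resU f (le_inf (inf_le_left.trans inf_le_left) inf_le_right :
          L.U i ⊓ L.U j ⊓ L.U k ≤ L.U i ⊓ L.U k),
        ← map_mul, L.cocycle]
    intro x hx
    have hx' : x ∈ (↑(f ⁻¹ᵁ L.U i ⊓ f ⁻¹ᵁ L.U j ⊓ f ⁻¹ᵁ L.U k) : Set Y) := hx
    rw [Opens.coe_inf, Opens.coe_inf] at hx'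
    exact ⟨⟨hx'.1.1, hx'.1.2⟩, hx'.2⟩
    all_goals exact fun x hx => ⟨⟨hx.1.1, hx.1.2⟩, hx.2⟩

/-- Tensor product of two line bundles on the same open set. -/
def mul (L M : LineBundleOn X V) : LineBundleOn X V where
  ι := L.ι × M.ι
  U p := L.U p.1 ⊓ M.U p.2
  le p := inf_le_left.trans (L.le p.1)
  covers x hx := by
    obtain ⟨i, hi⟩ := L.covers x hx
    obtain ⟨a, ha⟩ := M.covers x hx
    exact ⟨(i, a), ⟨hi, ha⟩⟩
  t p q := resU X (le_inf (inf_le_left.trans inf_le_left) (inf_le_right.trans inf_le_left))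
      (L.t p.1 q.1) *
    resU X (le_inf (inf_le_left.trans inf_le_right) (inf_le_right.trans inf_le_right))
      (M.t p.2 q.2)
  cocycle := by
    rintro ⟨i, a⟩ ⟨j, b⟩ ⟨k, c⟩
    simp only [map_mul, resU_resU]
    rw [mul_mul_mul_comm,
      L.cocycle_res i j k (h := le_inf (le_inf
        ((inf_le_left.trans inf_le_left).trans inf_le_left)
        ((inf_le_left.trans inf_le_right).trans inf_le_left))
        (inf_le_right.trans inf_le_left)),
      M.cocycle_res a b c (h := le_inf (le_inf
        ((inf_le_left.trans inf_le_left).trans inf_le_right)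
        ((inf_le_left.trans inf_le_right).trans inf_le_right))
        (inf_le_right.trans inf_le_right))]

/-- Restriction of a line bundle to a smaller open set. -/
def restrict (L : LineBundleOn X V) {V' : X.Opens} (h : V' ≤ V) : LineBundleOn X V' where
  ι := L.ι
  U i := L.U i ⊓ V'
  le i := inf_le_right
  covers x hx := by
    obtain ⟨i, hi⟩ := L.covers x (h hx)
    exact ⟨i, ⟨hi, hx⟩⟩
  t i j := resU X (le_inf (inf_le_left.trans inf_le_left)
      (inf_le_right.trans inf_le_left)) (L.t i j)
  cocycle i j k := by
    simp only [resU_resU]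
    exact L.cocycle_res i j k (h := le_inf (le_inf
      (inf_le_left.trans (inf_le_left.trans inf_le_left))
      (inf_le_left.trans (inf_le_right.trans inf_le_left)))
      (inf_le_right.trans inf_le_left)) _ _ _

/-- Two line bundles are isomorphic iff `L ⊗ M⁻¹` is trivial. -/
def Isomorphic (L M : LineBundleOn X V) : Prop :=
  IsTrivial (mul L (inv M))

end LineBundleOn

/-- `depth ≥ n` for a local ring: there is a weakly regular sequence of length `n`
inside the maximal ideal. -/
def DepthGE (R : Type u) [CommRing R] [IsLocalRing R] (n : ℕ) : Prop :=
  ∃ rs : List R, rs.length = n ∧ (∀ r ∈ rs, r ∈ IsLocalRing.maximalIdeal R) ∧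
    RingTheory.Sequence.IsWeaklyRegular R rs

/-- A morphism of schemes is flat if all of its stalk maps are flat ring maps. -/
def IsFlatMorphism {X Y : Scheme.{u}} (f : X ⟶ Y) : Prop :=
  ∀ x : X,
    letI : Algebra ↥(Y.presheaf.stalk (f.base x)) ↥(X.presheaf.stalk x) :=
      RingHom.toAlgebra (f.stalkMap x).hom
    Module.Flat ↥(Y.presheaf.stalk (f.base x)) ↥(X.presheaf.stalk x)

/-- Serre's condition `S2` for a scheme: for every point, the depth of the local ring is
at least `min 2 (dim)`. -/
def IsS2Scheme (X : Scheme.{u}) : Prop :=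
  ∀ (x : X) (n : ℕ), (n : WithBot (WithTop ℕ)) ≤
      min 2 (ringKrullDim ↥(X.presheaf.stalk x)) → DepthGE ↥(X.presheaf.stalk x) n

namespace LineBundleOn

variable {X : Scheme.{u}} {V : X.Opens}

/-- A compatible family of local sections of a line bundle over an open set `W`:
an element of `(j_* L)(W)` where `j : V → X` is the inclusion. -/
def IsCompatFamily (L : LineBundleOn X V) (W : X.Opens) (s : ∀ i, ↥Γ(X, W ⊓ L.U i)) :
    Prop :=
  ∀ i j,
    resS X (le_inf inf_le_left (inf_le_right.trans inf_le_left) :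
        W ⊓ (L.U i ⊓ L.U j) ≤ W ⊓ L.U i) (s i) =
      ((resU X (inf_le_right : W ⊓ (L.U i ⊓ L.U j) ≤ L.U i ⊓ L.U j) (L.t i j) :
        (Γ(X, W ⊓ (L.U i ⊓ L.U j)))ˣ) : ↥Γ(X, W ⊓ (L.U i ⊓ L.U j))) *
      resS X (le_inf inf_le_left (inf_le_right.trans inf_le_right)) (s j)

/-- The pushforward `j_* L` of a line bundle `L` on `V ⊆ X` to `X` is an invertible
(i.e. locally free of rank one) `O_X`-module:  every point has a neighborhood `W`
carrying a generating compatible family `g` such that over every smaller open `W'`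
every compatible family is a unique multiple of (the restriction of) `g`. -/
def PushforwardInvertible (L : LineBundleOn X V) : Prop :=
  ∀ x : X, ∃ (W : X.Opens) (_ : x ∈ W) (g : ∀ i, ↥Γ(X, W ⊓ L.U i)),
    IsCompatFamily L W g ∧
    ∀ (W' : X.Opens) (hW' : W' ≤ W) (s : ∀ i, ↥Γ(X, W' ⊓ L.U i)),
      IsCompatFamily L W' s →
      ∃! a : ↥Γ(X, W'), ∀ i,
        s i = resS X inf_le_left a * resS X (inf_le_inf hW' le_rfl) (g i)

end LineBundleOn


section Hex
open Function

universe v w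
variable {A : Type v} [CommRing A]

lemma length_mid {M N P : Type*} [AddCommGroup M] [AddCommGroup N] [AddCommGroup P]
    [Module A M] [Module A N] [Module A P] (f : M →ₗ[A] N) (g : N →ₗ[A] P) (h : Exact f g) :
    Module.length A N = Module.length A (LinearMap.range f) + Module.length A (LinearMap.range g) := by
  refine Module.length_eq_add_of_exact (LinearMap.range f).subtype g.rangeRestrict
    (Submodule.subtype_injective _) g.surjective_rangeRestrict ?_
  intro x
  constructor
  · intro hx
    have : g x = 0 := congrArg Subtype.val hx
    obtain ⟨y, hy⟩ := (h x).1 this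
    exact ⟨⟨x, y, hy⟩, rfl⟩
  · rintro ⟨⟨_, y, rfl⟩, rfl⟩
    exact Subtype.ext ((h _).2 ⟨y, rfl⟩)

/-- homology of a two-periodic complex at `P`. -/
abbrev HH {P Q : Type*} [AddCommGroup P] [AddCommGroup Q] [Module A P] [Module A Q]
    (f : P →ₗ[A] Q) (g : Q →ₗ[A] P) : Type _ :=
  (LinearMap.ker f) ⧸ (LinearMap.range g).submoduleOf (LinearMap.ker f)

section one
variable {P Q P' Q' : Type*} [AddCommGroup P] [AddCommGroup Q] [Module A P] [Module A Q]
  [AddCommGroup P'] [AddCommGroup Q'] [Module A P'] [Module A Q']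

/-- the class of a cycle -/
def HH.mk (f : P →ₗ[A] Q) (g : Q →ₗ[A] P) (x : P) (hx : f x = 0) : HH f g :=
  Submodule.Quotient.mk ⟨x, hx⟩

lemma HH.ind (f : P →ₗ[A] Q) (g : Q →ₗ[A] P) (x : HH f g) : ∃ y hy, x = HH.mk f g y hy := by
  obtain ⟨⟨y, hy⟩, rfl⟩ := Submodule.Quotient.mk_surjective _ x
  exact ⟨y, hy, rfl⟩

lemma HH.mk_eq_zero (f : P →ₗ[A] Q) (g : Q →ₗ[A] P) (x : P) (hx : f x = 0) :
    HH.mk f g x hx = 0 ↔ ∃ y, g y = x := by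
  unfold HH.mk
  rw [Submodule.Quotient.mk_eq_zero]
  rfl

lemma HH.mk_sub (f : P →ₗ[A] Q) (g : Q →ₗ[A] P) (x : P) (hx : f x = 0) (y : P) (hy : f y = 0) :
    HH.mk f g x hx - HH.mk f g y hy = HH.mk f g (x - y) (by simp [hx, hy]) := rfl

lemma HH.smul_mk (f : P →ₗ[A] Q) (g : Q →ₗ[A] P) (c : A) (x : P) (hx : f x = 0) :
    c • HH.mk f g x hx = HH.mk f g (c • x) (by simp [hx]) := rfl

/-- functoriality -/
def HH.map (f : P →ₗ[A] Q) (g : Q →ₗ[A] P) (f' : P' →ₗ[A] Q') (g' : Q' →ₗ[A] P')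
    (a : P →ₗ[A] P') (b : Q →ₗ[A] Q') (h1 : ∀ x, f' (a x) = b (f x))
    (h2 : ∀ x, g' (b x) = a (g x)) : HH f g →ₗ[A] HH f' g' :=
  Submodule.mapQ _ _ (a.restrict (p := LinearMap.ker f) (q := LinearMap.ker f') (by
    intro x hx; rw [LinearMap.mem_ker] at *; rw [h1, hx, map_zero])) (by
    rintro ⟨x, hx⟩ ⟨y, hy⟩
    exact ⟨b y, by rw [h2, hy]; rfl⟩)

lemma HH.map_mk (f : P →ₗ[A] Q) (g : Q →ₗ[A] P) (f' : P' →ₗ[A] Q') (g' : Q' →ₗ[A] P')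
    (a : P →ₗ[A] P') (b : Q →ₗ[A] Q') (h1 : ∀ x, f' (a x) = b (f x))
    (h2 : ∀ x, g' (b x) = a (g x)) (x : P) (hx : f x = 0) :
    HH.map f g f' g' a b h1 h2 (HH.mk f g x hx) = HH.mk f' g' (a x) (by rw [h1, hx, map_zero]) :=
  rfl

end one

/-- a short exact sequence of two-periodic complexes -/
structure SES2 {P₁ Q₁ P₂ Q₂ P₃ Q₃ : Type*}
  [AddCommGroup P₁] [AddCommGroup Q₁] [Module A P₁] [Module A Q₁]
  [AddCommGroup P₂] [AddCommGroup Q₂] [Module A P₂] [Module A Q₂]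
  [AddCommGroup P₃] [AddCommGroup Q₃] [Module A P₃] [Module A Q₃]
  (f₁ : P₁ →ₗ[A] Q₁) (g₁ : Q₁ →ₗ[A] P₁) (f₂ : P₂ →ₗ[A] Q₂) (g₂ : Q₂ →ₗ[A] P₂)
  (f₃ : P₃ →ₗ[A] Q₃) (g₃ : Q₃ →ₗ[A] P₃)
  (a : P₁ →ₗ[A] P₂) (a' : P₂ →ₗ[A] P₃) (b : Q₁ →ₗ[A] Q₂) (b' : Q₂ →ₗ[A] Q₃) : Prop where
  fg₂ : ∀ x, f₂ (g₂ x) = 0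
  gf₂ : ∀ x, g₂ (f₂ x) = 0
  h1 : ∀ x, f₂ (a x) = b (f₁ x)
  h2 : ∀ x, g₂ (b x) = a (g₁ x)
  h1' : ∀ x, f₃ (a' x) = b' (f₂ x)
  h2' : ∀ x, g₃ (b' x) = a' (g₂ x)
  ea : Exact a a'
  eb : Exact b b'
  ia : Injective a
  ib : Injective b
  sa : Surjective a'
  sb : Surjective b'

section three
variable {P₁ Q₁ P₂ Q₂ P₃ Q₃ : Type*}
  [AddCommGroup P₁] [AddCommGroup Q₁] [Module A P₁] [Module A Q₁]
  [AddCommGroup P₂] [AddCommGroup Q₂] [Module A P₂] [Module A Q₂]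
  [AddCommGroup P₃] [AddCommGroup Q₃] [Module A P₃] [Module A Q₃]
  {f₁ : P₁ →ₗ[A] Q₁} {g₁ : Q₁ →ₗ[A] P₁} {f₂ : P₂ →ₗ[A] Q₂} {g₂ : Q₂ →ₗ[A] P₂}
  {f₃ : P₃ →ₗ[A] Q₃} {g₃ : Q₃ →ₗ[A] P₃}
  {a : P₁ →ₗ[A] P₂} {a' : P₂ →ₗ[A] P₃} {b : Q₁ →ₗ[A] Q₂} {b' : Q₂ →ₗ[A] Q₃}

lemma SES2.swap (h : SES2 f₁ g₁ f₂ g₂ f₃ g₃ a a' b b') : SES2 g₁ f₁ g₂ f₂ g₃ f₃ b b' a a' :=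
  ⟨h.gf₂, h.fg₂, h.h2, h.h1, h.h2', h.h1', h.eb, h.ea, h.ib, h.ia, h.sb, h.sa⟩

lemma SES2.exact_mid (H : SES2 f₁ g₁ f₂ g₂ f₃ g₃ a a' b b') :
    Exact (HH.map f₁ g₁ f₂ g₂ a b H.h1 H.h2) (HH.map f₂ g₂ f₃ g₃ a' b' H.h1' H.h2') := by
  intro x
  obtain ⟨x, hx, rfl⟩ := HH.ind _ _ x
  rw [HH.map_mk, HH.mk_eq_zero]
  constructor
  · rintro ⟨y, hy⟩
    obtain ⟨y, rfl⟩ := H.sb y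
    rw [H.h2'] at hy
    have : a' (x - g₂ y) = 0 := by rw [map_sub, hy, sub_self]
    obtain ⟨z, hz⟩ := (H.ea _).1 this
    have h : f₁ z = 0 := by
      apply H.ib
      rw [← H.h1, hz, map_sub, hx, H.fg₂]; simp
    refine ⟨HH.mk _ _ z h, ?_⟩
    rw [HH.map_mk, ← sub_eq_zero, HH.mk_sub, HH.mk_eq_zero]
    exact ⟨-y, by rw [hz]; simp⟩
  · rintro ⟨y, hy⟩
    obtain ⟨y, hy', rfl⟩ := HH.ind _ _ y
    rw [HH.map_mk, ← sub_eq_zero, HH.mk_sub, HH.mk_eq_zero] at hy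
    obtain ⟨w, hw⟩ := hy
    refine ⟨- b' w, ?_⟩
    rw [map_neg, H.h2', hw, map_sub, H.ea.apply_apply_eq_zero]; simp

lemma SES2.fg₁ (H : SES2 f₁ g₁ f₂ g₂ f₃ g₃ a a' b b') (x) : f₁ (g₁ x) = 0 := by
  apply H.ib
  rw [← H.h1, ← H.h2, H.fg₂, map_zero]

lemma SES2.fg₃ (H : SES2 f₁ g₁ f₂ g₂ f₃ g₃ a a' b b') (x) : f₃ (g₃ x) = 0 := by
  obtain ⟨x, rfl⟩ := H.sb x
  rw [H.h2', H.h1', H.fg₂, map_zero]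

/-- the connecting homomorphism exists -/
lemma SES2.exists_delta (H : SES2 f₁ g₁ f₂ g₂ f₃ g₃ a a' b b') :
    ∃ δ : HH f₃ g₃ →ₗ[A] HH g₁ f₁, Exact (HH.map f₂ g₂ f₃ g₃ a' b' H.h1' H.h2') δ ∧
      Exact δ (HH.map g₁ f₁ g₂ f₂ b a H.h2 H.h1) := by
  -- vertical maps `ker f₃ → Q₂ / ...` realised through the snake lemma
  let v₁ : (P₁ ⧸ LinearMap.range g₁) →ₗ[A] LinearMap.ker g₁ :=
    Submodule.liftQ _ (f₁.codRestrict (LinearMap.ker g₁) H.swap.fg₁) (by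
      rintro _ ⟨y, rfl⟩; exact Subtype.ext (H.fg₁ y))
  let v₂ : (P₂ ⧸ LinearMap.range g₂) →ₗ[A] LinearMap.ker g₂ :=
    Submodule.liftQ _ (f₂.codRestrict (LinearMap.ker g₂) H.gf₂) (by
      rintro _ ⟨y, rfl⟩; exact Subtype.ext (H.fg₂ y))
  let v₃ : (P₃ ⧸ LinearMap.range g₃) →ₗ[A] LinearMap.ker g₃ :=
    Submodule.liftQ _ (f₃.codRestrict (LinearMap.ker g₃) H.swap.fg₃) (by
      rintro _ ⟨y, rfl⟩; exact Subtype.ext (H.fg₃ y))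
  let p₁ : (P₁ ⧸ LinearMap.range g₁) →ₗ[A] (P₂ ⧸ LinearMap.range g₂) :=
    Submodule.mapQ _ _ a (by rintro _ ⟨y, rfl⟩; exact ⟨b y, H.h2 y⟩)
  let p₂ : (P₂ ⧸ LinearMap.range g₂) →ₗ[A] (P₃ ⧸ LinearMap.range g₃) :=
    Submodule.mapQ _ _ a' (by rintro _ ⟨y, rfl⟩; exact ⟨b' y, H.h2' y⟩)
  let q₁ : LinearMap.ker g₁ →ₗ[A] LinearMap.ker g₂ := b.restrict (by
    intro x hx; rw [LinearMap.mem_ker] at *; rw [H.h2, hx, map_zero])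
  let q₂ : LinearMap.ker g₂ →ₗ[A] LinearMap.ker g₃ := b'.restrict (by
    intro x hx; rw [LinearMap.mem_ker] at *; rw [H.h2', hx, map_zero])
  let κ₂ : HH f₂ g₂ →ₗ[A] (P₂ ⧸ LinearMap.range g₂) :=
    Submodule.mapQ _ _ (LinearMap.ker f₂).subtype (by rintro ⟨x, hx⟩ h; exact h)
  let κ₃ : HH f₃ g₃ →ₗ[A] (P₃ ⧸ LinearMap.range g₃) :=
    Submodule.mapQ _ _ (LinearMap.ker f₃).subtype (by rintro ⟨x, hx⟩ h; exact h)
  have hp : Exact p₁ p₂ := by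
    intro x
    obtain ⟨x, rfl⟩ := Submodule.Quotient.mk_surjective _ x
    constructor
    · intro h
      obtain ⟨y, hy⟩ := (Submodule.Quotient.mk_eq_zero _).1 h
      obtain ⟨y, rfl⟩ := H.sb y
      rw [H.h2'] at hy
      obtain ⟨z, hz⟩ := (H.ea (x - g₂ y)).1 (by rw [map_sub, hy, sub_self])
      refine ⟨Submodule.Quotient.mk z, ?_⟩
      refine (Submodule.Quotient.eq _).2 ⟨-y, ?_⟩
      rw [hz]; simp
    · rintro ⟨y, hy⟩
      obtain ⟨y, rfl⟩ := Submodule.Quotient.mk_surjective _ y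
      rw [← hy]
      refine (Submodule.Quotient.mk_eq_zero _).2 ?_
      rw [H.ea.apply_apply_eq_zero]; exact zero_mem _
  have hq : Exact q₁ q₂ := by
    rintro ⟨x, hx⟩
    constructor
    · intro h
      obtain ⟨y, hy⟩ := (H.eb x).1 (congrArg Subtype.val h)
      refine ⟨⟨y, ?_⟩, Subtype.ext hy⟩
      apply H.ia
      rw [← H.h2, hy, map_zero]; exact hx
    · rintro ⟨⟨y, hy⟩, h⟩
      have h' : b y = x := congrArg Subtype.val h
      refine Subtype.ext ?_
      show b' x = 0
      rw [← h', H.eb.apply_apply_eq_zero]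
  have hv1 : q₁.comp v₁ = v₂.comp p₁ := by
    ext x
    exact (H.h1 x).symm
  have hv2 : q₂.comp v₂ = v₃.comp p₂ := by
    ext x
    exact (H.h1' x).symm
  have hsp : Surjective p₂ := by
    intro x
    obtain ⟨x, rfl⟩ := Submodule.Quotient.mk_surjective _ x
    obtain ⟨x, rfl⟩ := H.sa x
    exact ⟨Submodule.Quotient.mk x, rfl⟩
  have hiq : Injective q₁ := by
    rintro ⟨x, hx⟩ ⟨y, hy⟩ h
    exact Subtype.ext (H.ib (congrArg Subtype.val h))
  have ek₂ : Exact κ₂ v₂ := by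
    intro x
    obtain ⟨x, rfl⟩ := Submodule.Quotient.mk_surjective _ x
    constructor
    · intro h
      exact ⟨HH.mk _ _ x (congrArg Subtype.val h), rfl⟩
    · rintro ⟨y, hy⟩
      obtain ⟨y, hy', rfl⟩ := HH.ind _ _ y
      rw [← hy]
      exact Subtype.ext hy'
  have ek₃ : Exact κ₃ v₃ := by
    intro x
    obtain ⟨x, rfl⟩ := Submodule.Quotient.mk_surjective _ x
    constructor
    · intro h
      exact ⟨HH.mk _ _ x (congrArg Subtype.val h), rfl⟩
    · rintro ⟨y, hy⟩
      obtain ⟨y, hy', rfl⟩ := HH.ind _ _ y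
      rw [← hy]
      exact Subtype.ext hy'
  have ec₁ : Exact v₁ ((LinearMap.range f₁).submoduleOf (LinearMap.ker g₁)).mkQ := by
    intro x
    constructor
    · intro h
      obtain ⟨y, hy⟩ := (Submodule.Quotient.mk_eq_zero _).1 h
      exact ⟨Submodule.Quotient.mk y, Subtype.ext hy⟩
    · rintro ⟨y, rfl⟩
      obtain ⟨y, rfl⟩ := Submodule.Quotient.mk_surjective _ y
      exact (Submodule.Quotient.mk_eq_zero _).2 ⟨y, rfl⟩
  have ec₂ : Exact v₂ ((LinearMap.range f₂).submoduleOf (LinearMap.ker g₂)).mkQ := by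
    intro x
    constructor
    · intro h
      obtain ⟨y, hy⟩ := (Submodule.Quotient.mk_eq_zero _).1 h
      exact ⟨Submodule.Quotient.mk y, Subtype.ext hy⟩
    · rintro ⟨y, rfl⟩
      obtain ⟨y, rfl⟩ := Submodule.Quotient.mk_surjective _ y
      exact (Submodule.Quotient.mk_eq_zero _).2 ⟨y, rfl⟩
  have hik : Injective κ₃ := by
    rw [injective_iff_map_eq_zero]
    intro x hx
    obtain ⟨x, hx', rfl⟩ := HH.ind _ _ x
    exact (HH.mk_eq_zero _ _ _ _).2 ((Submodule.Quotient.mk_eq_zero _).1 hx)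
  refine ⟨SnakeLemma.δ' v₁ v₂ v₃ p₁ p₂ hp q₁ q₂ hq hv1 hv2 κ₃ ek₃ _ ec₁ hsp hiq,
    SnakeLemma.exact_δ'_right v₁ v₂ v₃ p₁ p₂ hp q₁ q₂ hq hv1 hv2 κ₂ ek₂ κ₃ ek₃ _ ec₁ hsp hiq
      _ ?_ hik,
    SnakeLemma.exact_δ'_left v₁ v₂ v₃ p₁ p₂ hp q₁ q₂ hq hv1 hv2 κ₃ ek₃ _ ec₁ _ ec₂ hsp hiq
      _ ?_ (Submodule.mkQ_surjective _)⟩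
  · ext x
    rfl
  · ext x
    rfl

/-- the hexagon identity for lengths -/
lemma SES2.length_eq (H : SES2 f₁ g₁ f₂ g₂ f₃ g₃ a a' b b') :
    Module.length A (HH f₁ g₁) + Module.length A (HH f₃ g₃) + Module.length A (HH g₂ f₂) =
    Module.length A (HH g₁ f₁) + Module.length A (HH g₃ f₃) + Module.length A (HH f₂ g₂) := by
  obtain ⟨δ, e1, e2⟩ := H.exists_delta
  obtain ⟨δ', e1', e2'⟩ := H.swap.exists_delta
  have e3 := H.exact_mid
  have e3' := H.swap.exact_mid
  rw [length_mid _ _ e1, length_mid _ _ e2, length_mid _ _ e1', length_mid _ _ e2',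
    length_mid _ _ e3, length_mid _ _ e3']
  abel

lemma length_ne_top_mid {M N P : Type*} [AddCommGroup M] [AddCommGroup N] [AddCommGroup P]
    [Module A M] [Module A N] [Module A P] (f : M →ₗ[A] N) (g : N →ₗ[A] P) (h : Exact f g)
    (hM : Module.length A M ≠ ⊤) (hP : Module.length A P ≠ ⊤) : Module.length A N ≠ ⊤ := by
  rw [length_mid f g h]
  refine WithTop.add_ne_top.2 ⟨?_, ?_⟩
  · exact ne_top_of_le_ne_top hM (Module.length_le_of_surjective _ f.surjective_rangeRestrict)
  · exact ne_top_of_le_ne_top hP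
      (Module.length_le_of_injective (LinearMap.range g).subtype (Submodule.subtype_injective _))

lemma SES2.fin_mid (H : SES2 f₁ g₁ f₂ g₂ f₃ g₃ a a' b b')
    (h1 : Module.length A (HH f₁ g₁) ≠ ⊤) (h3 : Module.length A (HH f₃ g₃) ≠ ⊤) :
    Module.length A (HH f₂ g₂) ≠ ⊤ :=
  length_ne_top_mid _ _ H.exact_mid h1 h3

lemma SES2.fin_right (H : SES2 f₁ g₁ f₂ g₂ f₃ g₃ a a' b b')
    (h1 : Module.length A (HH g₁ f₁) ≠ ⊤) (h2 : Module.length A (HH f₂ g₂) ≠ ⊤) :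
    Module.length A (HH f₃ g₃) ≠ ⊤ := by
  obtain ⟨δ, e1, e2⟩ := H.exists_delta
  exact length_ne_top_mid _ _ e1 h2 h1

end three

lemma HH.length_le {P Q : Type*} [AddCommGroup P] [AddCommGroup Q] [Module A P] [Module A Q]
    (f : P →ₗ[A] Q) (g : Q →ₗ[A] P) : Module.length A (HH f g) ≤ Module.length A P :=
  (Module.length_le_of_surjective _ (Submodule.mkQ_surjective _)).trans
    (Module.length_le_of_injective (LinearMap.ker f).subtype (Submodule.subtype_injective _))

lemma HH.key {P Q : Type*} [AddCommGroup P] [AddCommGroup Q] [Module A P] [Module A Q]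
    (f : P →ₗ[A] Q) (g : Q →ₗ[A] P) (fg : ∀ x, f (g x) = 0) :
    Module.length A (LinearMap.ker f) =
      Module.length A (LinearMap.range g) + Module.length A (HH f g) := by
  have hle : LinearMap.range g ≤ LinearMap.ker f := by rintro _ ⟨y, rfl⟩; exact fg y
  refine Module.length_eq_add_of_exact (Submodule.inclusion hle)
    (Submodule.mkQ _) (Submodule.inclusion_injective _) (Submodule.mkQ_surjective _) ?_
  intro x
  constructor
  · intro h
    obtain ⟨y, hy⟩ := (Submodule.Quotient.mk_eq_zero _).1 h
    exact ⟨⟨_, y, rfl⟩, Subtype.ext hy⟩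
  · rintro ⟨⟨_, y, rfl⟩, rfl⟩
    exact (Submodule.Quotient.mk_eq_zero _).2 ⟨y, rfl⟩

lemma HH.hr {P Q : Type*} [AddCommGroup P] [AddCommGroup Q] [Module A P] [Module A Q]
      (f : P →ₗ[A] Q) : Module.length A P = Module.length A (LinearMap.ker f) +
        Module.length A (LinearMap.range f) := by
  refine Module.length_eq_add_of_exact (LinearMap.ker f).subtype f.rangeRestrict
    (Submodule.subtype_injective _) f.surjective_rangeRestrict ?_
  intro x
  exact ⟨fun h => ⟨⟨x, congrArg Subtype.val h⟩, rfl⟩, by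
    rintro ⟨⟨y, hy⟩, rfl⟩; exact Subtype.ext hy⟩

/-- for a complex of finite length modules, the Euler characteristic is that of homology -/
lemma HH.euler {P Q : Type*} [AddCommGroup P] [AddCommGroup Q] [Module A P] [Module A Q]
    (f : P →ₗ[A] Q) (g : Q →ₗ[A] P) (fg : ∀ x, f (g x) = 0) (gf : ∀ x, g (f x) = 0) :
    Module.length A P + Module.length A (HH g f) = Module.length A Q + Module.length A (HH f g) := by
  rw [HH.hr f, HH.hr g, HH.key f g fg, HH.key g f gf]
  abel

end Hex


section Sys
open Function

universe v w

lemma length_ne_top_of_kill {A : Type v} [CommRing A] [IsNoetherianRing A] {ι : Type*} (g : ι → A)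
    (hg : ∀ p : Ideal A, p.IsPrime → (∀ c, g c ∈ p) → p.IsMaximal)
    (M : Type*) [AddCommGroup M] [Module A M] [Module.Finite A M]
    (hM : ∀ c, ∃ m : ℕ, ∀ x : M, g c ^ m • x = 0) : Module.length A M ≠ ⊤ := by
  let I := Module.annihilator A M
  have hI : ∀ c, ∃ m : ℕ, g c ^ m ∈ I := fun c => by
    obtain ⟨m, hm⟩ := hM c
    exact ⟨m, Module.mem_annihilator.2 hm⟩
  have hd : Ring.KrullDimLE 0 (A ⧸ I) := by
    rw [Ring.krullDimLE_zero_iff]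
    intro P hP
    have : (P.comap (Ideal.Quotient.mk I)).IsMaximal := by
      apply hg _ inferInstance
      intro c
      obtain ⟨m, hm⟩ := hI c
      have : g c ^ m ∈ P.comap (Ideal.Quotient.mk I) := by
        rw [Ideal.mem_comap, Ideal.Quotient.eq_zero_iff_mem.2 hm]; exact zero_mem _
      exact (Ideal.IsPrime.mem_of_pow_mem inferInstance _ this)
    have h := Ideal.map_eq_top_or_isMaximal_of_surjective (Ideal.Quotient.mk I)
      Ideal.Quotient.mk_surjective this
    rw [Ideal.map_comap_of_surjective _ Ideal.Quotient.mk_surjective] at h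
    exact h.resolve_left hP.ne_top
  have : IsArtinianRing (A ⧸ I) := isArtinianRing_iff_krullDimLE_zero.2 hd
  let _ : Module (A ⧸ I) M := Module.IsTorsionBySet.module (fun x a => Module.mem_annihilator.1 a.2 x)
  have : IsScalarTower A (A ⧸ I) M := Module.IsTorsionBySet.isScalarTower _
  have : Module.Finite (A ⧸ I) M := Module.Finite.of_restrictScalars_finite A _ _
  rw [Module.length_eq_of_surjective (S := A) (R := A ⧸ I) Ideal.Quotient.mk_surjective]
  exact Module.length_ne_top

/-- abstract two-periodic systems -/
structure Sys (A : Type v) [CommRing A] {ι : Type} (g : ι → A) (ϖ : A) where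
  P0 : ℕ → Type w
  P1 : ℕ → Type w
  E0 : Type w
  E1 : Type w
  [iP0 : ∀ n, AddCommGroup (P0 n)]
  [iP1 : ∀ n, AddCommGroup (P1 n)]
  [iE0 : AddCommGroup E0]
  [iE1 : AddCommGroup E1]
  [mP0 : ∀ n, Module A (P0 n)]
  [mP1 : ∀ n, Module A (P1 n)]
  [mE0 : Module A E0]
  [mE1 : Module A E1]
  d0 : ∀ n, P0 n →ₗ[A] P1 n
  d1 : ∀ n, P1 n →ₗ[A] P0 n
  D0 : E0 →ₗ[A] E1
  D1 : E1 →ₗ[A] E0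
  e0 : ∀ n, P0 n →ₗ[A] E0
  e1 : ∀ n, P1 n →ₗ[A] E1
  s0 : ι → ∀ n, P0 n →ₗ[A] P0 (n + 1)
  s1 : ι → ∀ n, P1 n →ₗ[A] P1 (n + 1)
  u0 : ι → ∀ n, P0 (n + 1) →ₗ[A] P0 n
  u1 : ι → ∀ n, P1 (n + 1) →ₗ[A] P1 n
  x0 : ι → E0 →ₗ[A] E0
  x1 : ι → E1 →ₗ[A] E1
  fin0 : ∀ n, Module.Finite A (P0 n)
  fin1 : ∀ n, Module.Finite A (P1 n)
  dd0 : ∀ n x, d1 n (d0 n x) = 0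
  dd1 : ∀ n x, d0 n (d1 n x) = 0
  DD0 : ∀ x, D1 (D0 x) = 0
  DD1 : ∀ x, D0 (D1 x) = 0
  De0 : ∀ n x, D0 (e0 n x) = e1 n (d0 n x)
  De1 : ∀ n x, D1 (e1 n x) = e0 n (d1 n x)
  inj0 : ∀ n (x : P0 n), ϖ • x = 0 → x = 0
  inj1 : ∀ n (x : P1 n), ϖ • x = 0 → x = 0
  ker0 : ∀ n (x : P0 n), e0 n x = 0 ↔ ∃ y, ϖ • y = x
  ker1 : ∀ n (x : P1 n), e1 n x = 0 ↔ ∃ y, ϖ • y = x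
  cok0 : ∀ n, Module.length A (E0 ⧸ LinearMap.range (e0 n)) ≠ ⊤
  cok1 : ∀ n, Module.length A (E1 ⧸ LinearMap.range (e1 n)) ≠ ⊤
  ds0 : ∀ c n x, d0 _ (s0 c n x) = s1 c n (d0 n x)
  ds1 : ∀ c n x, d1 _ (s1 c n x) = s0 c n (d1 n x)
  du0 : ∀ c n x, d0 _ (u0 c n x) = u1 c n (d0 _ x)
  du1 : ∀ c n x, d1 _ (u1 c n x) = u0 c n (d1 _ x)
  ss0 : ∀ c c' n x, s0 c _ (s0 c' n x) = s0 c' _ (s0 c n x)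
  ss1 : ∀ c c' n x, s1 c _ (s1 c' n x) = s1 c' _ (s1 c n x)
  us0 : ∀ c c' n x, u0 c _ (s0 c' _ x) = s0 c' _ (u0 c n x)
  us1 : ∀ c c' n x, u1 c _ (s1 c' _ x) = s1 c' _ (u1 c n x)
  usg0 : ∀ c n x, u0 c n (s0 c n x) = g c • x
  usg1 : ∀ c n x, u1 c n (s1 c n x) = g c • x
  sug0 : ∀ c n x, s0 c n (u0 c n x) = g c • x
  sug1 : ∀ c n x, s1 c n (u1 c n x) = g c • x
  es0 : ∀ c n x, e0 _ (s0 c n x) = x0 c (e0 n x)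
  es1 : ∀ c n x, e1 _ (s1 c n x) = x1 c (e1 n x)
  Dx0 : ∀ c x, D0 (x0 c x) = x1 c (D0 x)
  Dx1 : ∀ c x, D1 (x1 c x) = x0 c (D1 x)
  xx0 : ∀ c c' x, x0 c (x0 c' x) = x0 c' (x0 c x)
  xx1 : ∀ c c' x, x1 c (x1 c' x) = x1 c' (x1 c x)

attribute [instance] Sys.iP0 Sys.iP1 Sys.iE0 Sys.iE1 Sys.mP0 Sys.mP1 Sys.mE0 Sys.mE1
  Sys.fin0 Sys.fin1

variable {A : Type v} [CommRing A] {ι : Type} {g : ι → A} {ϖ : A}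

/-- signed length of the cokernel -/
noncomputable def Sys.ell (K : Sys.{v, w} A g ϖ) (n : ℕ) : ℤ :=
  ((Module.length A (K.E0 ⧸ LinearMap.range (K.e0 n))).toNat : ℤ) -
    ((Module.length A (K.E1 ⧸ LinearMap.range (K.e1 n))).toNat : ℤ)

/-- an element kills all homology -/
def Sys.Kills (K : Sys.{v, w} A g ϖ) (a : A) : Prop :=
  (∀ n x, K.d0 n x = 0 → ∃ y, K.d1 n y = a • x) ∧ (∀ n x, K.d1 n x = 0 → ∃ y, K.d0 n y = a • x)

lemma Sys.ses1 (K : Sys.{v, w} A g ϖ) (n : ℕ) :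
    SES2 (K.d0 n) (K.d1 n) (K.d0 n) (K.d1 n)
      (K.D0.restrict (p := LinearMap.range (K.e0 n)) (q := LinearMap.range (K.e1 n)) (by
        rintro _ ⟨y, rfl⟩; exact ⟨_, (K.De0 n y).symm⟩))
      (K.D1.restrict (p := LinearMap.range (K.e1 n)) (q := LinearMap.range (K.e0 n)) (by
        rintro _ ⟨y, rfl⟩; exact ⟨_, (K.De1 n y).symm⟩))
      (ϖ • LinearMap.id) (K.e0 n).rangeRestrict (ϖ • LinearMap.id) (K.e1 n).rangeRestrict where
  fg₂ := K.dd1 n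
  gf₂ := K.dd0 n
  h1 x := by simp
  h2 x := by simp
  h1' x := Subtype.ext (K.De0 n x)
  h2' x := Subtype.ext (K.De1 n x)
  ea x := by
    rw [← Subtype.coe_inj]
    exact K.ker0 n x
  eb x := by
    rw [← Subtype.coe_inj]
    exact K.ker1 n x
  ia := (injective_iff_map_eq_zero _).2 fun x hx => K.inj0 n x hx
  ib := (injective_iff_map_eq_zero _).2 fun x hx => K.inj1 n x hx
  sa := LinearMap.surjective_rangeRestrict _
  sb := LinearMap.surjective_rangeRestrict _

lemma Sys.ses2 (K : Sys.{v, w} A g ϖ) (n : ℕ) :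
    SES2
      (K.D0.restrict (p := LinearMap.range (K.e0 n)) (q := LinearMap.range (K.e1 n)) (by
        rintro _ ⟨y, rfl⟩; exact ⟨_, (K.De0 n y).symm⟩))
      (K.D1.restrict (p := LinearMap.range (K.e1 n)) (q := LinearMap.range (K.e0 n)) (by
        rintro _ ⟨y, rfl⟩; exact ⟨_, (K.De1 n y).symm⟩))
      K.D0 K.D1
      (Submodule.mapQ (LinearMap.range (K.e0 n)) (LinearMap.range (K.e1 n)) K.D0 (by
        rintro _ ⟨y, rfl⟩; exact ⟨_, (K.De0 n y).symm⟩))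
      (Submodule.mapQ (LinearMap.range (K.e1 n)) (LinearMap.range (K.e0 n)) K.D1 (by
        rintro _ ⟨y, rfl⟩; exact ⟨_, (K.De1 n y).symm⟩))
      (Submodule.subtype _) (Submodule.mkQ _) (Submodule.subtype _) (Submodule.mkQ _) where
  fg₂ := K.DD1
  gf₂ := K.DD0
  h1 x := rfl
  h2 x := rfl
  h1' x := rfl
  h2' x := rfl
  ea := LinearMap.exact_subtype_mkQ _
  eb := LinearMap.exact_subtype_mkQ _
  ia := Submodule.subtype_injective _
  ib := Submodule.subtype_injective _
  sa := Submodule.mkQ_surjective _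
  sb := Submodule.mkQ_surjective _

lemma enat_aux (a b c c' : ℕ∞) (ha : a ≠ ⊤) (hb : b ≠ ⊤) (h : a + c + b = b + c' + a) :
    c = c' := by
  rw [add_right_comm, add_right_comm b, add_comm a b, add_comm (b + a), add_comm (b + a)] at h
  exact (WithTop.add_right_inj (WithTop.add_ne_top.2 ⟨hb, ha⟩)).1 h

lemma enat_aux2 (l0 l1 r0 r1 c0 c1 e0 e1 : ℕ∞) (hl0 : l0 ≠ ⊤) (hl1 : l1 ≠ ⊤) (hr0 : r0 ≠ ⊤)
    (hc0 : c0 ≠ ⊤) (hc1 : c1 ≠ ⊤) (he0 : e0 ≠ ⊤) (he1 : e1 ≠ ⊤) (hr : r0 = r1)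
    (hh : r0 + c0 + e1 = r1 + c1 + e0) (eu : l0 + c1 = l1 + c0) :
    (l0.toNat : ℤ) - l1.toNat = e0.toNat - e1.toNat := by
  subst hr
  lift l0 to ℕ using hl0
  lift l1 to ℕ using hl1
  lift r0 to ℕ using hr0
  lift c0 to ℕ using hc0
  lift c1 to ℕ using hc1
  lift e0 to ℕ using he0
  lift e1 to ℕ using he1
  norm_cast at hh eu
  simp only [ENat.toNat_coe]
  omega

lemma Sys.ell_eq [IsNoetherianRing A] (K : Sys.{v, w} A g ϖ)
    (hg : ∀ p : Ideal A, p.IsPrime → (∀ c, g c ∈ p) → p.IsMaximal)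
    (hK : ∀ c, ∃ m : ℕ, K.Kills (g c ^ m)) (n : ℕ) :
    K.ell n = ((Module.length A (HH K.D0 K.D1)).toNat : ℤ) -
      ((Module.length A (HH K.D1 K.D0)).toNat : ℤ) := by
  have f0 : Module.length A (HH (K.d0 n) (K.d1 n)) ≠ ⊤ := by
    refine length_ne_top_of_kill g hg _ fun c => ?_
    obtain ⟨m, hm⟩ := hK c
    refine ⟨m, fun x => ?_⟩
    obtain ⟨x, hx, rfl⟩ := HH.ind _ _ x
    rw [HH.smul_mk, HH.mk_eq_zero]
    exact hm.1 n x hx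
  have f1 : Module.length A (HH (K.d1 n) (K.d0 n)) ≠ ⊤ := by
    refine length_ne_top_of_kill g hg _ fun c => ?_
    obtain ⟨m, hm⟩ := hK c
    refine ⟨m, fun x => ?_⟩
    obtain ⟨x, hx, rfl⟩ := HH.ind _ _ x
    rw [HH.smul_mk, HH.mk_eq_zero]
    exact hm.2 n x hx
  have r0 := (K.ses1 n).fin_right f1 f0
  have r1 := (K.ses1 n).swap.fin_right f0 f1
  have r := enat_aux _ _ _ _ f0 f1 (K.ses1 n).length_eq
  have c0 := ne_top_of_le_ne_top (K.cok0 n) (HH.length_le (P := K.E0 ⧸ LinearMap.range (K.e0 n))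
    (Submodule.mapQ (LinearMap.range (K.e0 n)) (LinearMap.range (K.e1 n)) K.D0 (by
        rintro _ ⟨y, rfl⟩; exact ⟨_, (K.De0 n y).symm⟩))
      (Submodule.mapQ (LinearMap.range (K.e1 n)) (LinearMap.range (K.e0 n)) K.D1 (by
        rintro _ ⟨y, rfl⟩; exact ⟨_, (K.De1 n y).symm⟩)))
  have c1 := ne_top_of_le_ne_top (K.cok1 n) (HH.length_le (P := K.E1 ⧸ LinearMap.range (K.e1 n))
      (Submodule.mapQ (LinearMap.range (K.e1 n)) (LinearMap.range (K.e0 n)) K.D1 (by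
        rintro _ ⟨y, rfl⟩; exact ⟨_, (K.De1 n y).symm⟩))
      (Submodule.mapQ (LinearMap.range (K.e0 n)) (LinearMap.range (K.e1 n)) K.D0 (by
        rintro _ ⟨y, rfl⟩; exact ⟨_, (K.De0 n y).symm⟩)))
  have e0 := (K.ses2 n).fin_mid r0 c0
  have e1 := (K.ses2 n).swap.fin_mid r1 c1
  have hh := (K.ses2 n).length_eq
  have eu := HH.euler _ _ (K.ses2 n).fg₃ (K.ses2 n).swap.fg₃
  exact enat_aux2 _ _ _ _ _ _ _ _ (K.cok0 n) (K.cok1 n) r0 c0 c1 e0 e1 r hh eu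

/-- quotient of a product map -/
lemma length_coker_prodMap {M N M' N' : Type*} [AddCommGroup M] [AddCommGroup N] [AddCommGroup M']
    [AddCommGroup N'] [Module A M] [Module A N] [Module A M'] [Module A N']
    (f : M →ₗ[A] N) (f' : M' →ₗ[A] N') :
    Module.length A ((N × N') ⧸ LinearMap.range (f.prodMap f')) =
      Module.length A (N ⧸ LinearMap.range f) + Module.length A (N' ⧸ LinearMap.range f') := by
  rw [← Module.length_prod]
  have hs : Surjective ((LinearMap.range f).mkQ.prodMap (LinearMap.range f').mkQ) :=
    Surjective.prodMap (Submodule.mkQ_surjective _) (Submodule.mkQ_surjective _)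
  have hk : LinearMap.range (f.prodMap f') =
      LinearMap.ker ((LinearMap.range f).mkQ.prodMap (LinearMap.range f').mkQ) := by
    rw [LinearMap.ker_prodMap, LinearMap.range_prodMap, Submodule.ker_mkQ, Submodule.ker_mkQ]
  rw [hk]
  exact (LinearMap.quotKerEquivOfSurjective _ hs).length_eq

/-- the cone of the operator `s c` -/
def Sys.cone (K : Sys.{v, w} A g ϖ) (c : ι) : Sys.{v, w} A g ϖ where
  P0 n := K.P0 (n + 1) × K.P1 n
  P1 n := K.P1 (n + 1) × K.P0 n
  E0 := K.E0 × K.E1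
  E1 := K.E1 × K.E0
  d0 n := ((K.d0 (n + 1)).coprod (K.s1 c n)).prod (-(K.d1 n ∘ₗ LinearMap.snd _ _ _))
  d1 n := ((K.d1 (n + 1)).coprod (K.s0 c n)).prod (-(K.d0 n ∘ₗ LinearMap.snd _ _ _))
  D0 := (K.D0.coprod (K.x1 c)).prod (-(K.D1 ∘ₗ LinearMap.snd _ _ _))
  D1 := (K.D1.coprod (K.x0 c)).prod (-(K.D0 ∘ₗ LinearMap.snd _ _ _))
  e0 n := (K.e0 (n + 1)).prodMap (K.e1 n)
  e1 n := (K.e1 (n + 1)).prodMap (K.e0 n)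
  s0 c n := (K.s0 c (n + 1)).prodMap (K.s1 c n)
  s1 c n := (K.s1 c (n + 1)).prodMap (K.s0 c n)
  u0 c n := (K.u0 c (n + 1)).prodMap (K.u1 c n)
  u1 c n := (K.u1 c (n + 1)).prodMap (K.u0 c n)
  x0 c := (K.x0 c).prodMap (K.x1 c)
  x1 c := (K.x1 c).prodMap (K.x0 c)
  fin0 n := inferInstance
  fin1 n := inferInstance
  dd0 n x := by ext <;> simp [K.dd0, K.dd1, K.ds1]
  dd1 n x := by ext <;> simp [K.dd0, K.dd1, K.ds0]
  DD0 x := by ext <;> simp [K.DD0, K.DD1, K.Dx1]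
  DD1 x := by ext <;> simp [K.DD0, K.DD1, K.Dx0]
  De0 n x := by ext <;> simp [K.De0, K.De1, K.es1]
  De1 n x := by ext <;> simp [K.De0, K.De1, K.es0]
  inj0 n x h := Prod.ext (K.inj0 _ _ (congrArg Prod.fst h)) (K.inj1 _ _ (congrArg Prod.snd h))
  inj1 n x h := Prod.ext (K.inj1 _ _ (congrArg Prod.fst h)) (K.inj0 _ _ (congrArg Prod.snd h))
  ker0 n x := by
    constructor
    · intro h
      obtain ⟨y, hy⟩ := (K.ker0 _ _).1 (congrArg Prod.fst h)
      obtain ⟨z, hz⟩ := (K.ker1 _ _).1 (congrArg Prod.snd h)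
      exact ⟨(y, z), Prod.ext hy hz⟩
    · rintro ⟨y, rfl⟩
      exact Prod.ext ((K.ker0 _ _).2 ⟨_, rfl⟩) ((K.ker1 _ _).2 ⟨_, rfl⟩)
  ker1 n x := by
    constructor
    · intro h
      obtain ⟨y, hy⟩ := (K.ker1 _ _).1 (congrArg Prod.fst h)
      obtain ⟨z, hz⟩ := (K.ker0 _ _).1 (congrArg Prod.snd h)
      exact ⟨(y, z), Prod.ext hy hz⟩
    · rintro ⟨y, rfl⟩
      exact Prod.ext ((K.ker1 _ _).2 ⟨_, rfl⟩) ((K.ker0 _ _).2 ⟨_, rfl⟩)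
  cok0 n := by
    rw [length_coker_prodMap]
    exact WithTop.add_ne_top.2 ⟨K.cok0 _, K.cok1 _⟩
  cok1 n := by
    rw [length_coker_prodMap]
    exact WithTop.add_ne_top.2 ⟨K.cok1 _, K.cok0 _⟩
  ds0 c' n x := by ext <;> simp [K.ds0, K.ds1, K.ss1 c c']
  ds1 c' n x := by ext <;> simp [K.ds0, K.ds1, K.ss0 c c']
  du0 c' n x := by ext <;> simp [K.du0, K.du1, K.us1]
  du1 c' n x := by ext <;> simp [K.du0, K.du1, K.us0]
  ss0 c c' n x := Prod.ext (K.ss0 _ _ _ _) (K.ss1 _ _ _ _)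
  ss1 c c' n x := Prod.ext (K.ss1 _ _ _ _) (K.ss0 _ _ _ _)
  us0 c c' n x := Prod.ext (K.us0 _ _ _ _) (K.us1 _ _ _ _)
  us1 c c' n x := Prod.ext (K.us1 _ _ _ _) (K.us0 _ _ _ _)
  usg0 c n x := Prod.ext (K.usg0 _ _ _) (K.usg1 _ _ _)
  usg1 c n x := Prod.ext (K.usg1 _ _ _) (K.usg0 _ _ _)
  sug0 c n x := Prod.ext (K.sug0 _ _ _) (K.sug1 _ _ _)
  sug1 c n x := Prod.ext (K.sug1 _ _ _) (K.sug0 _ _ _)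
  es0 c n x := Prod.ext (K.es0 _ _ _) (K.es1 _ _ _)
  es1 c n x := Prod.ext (K.es1 _ _ _) (K.es0 _ _ _)
  Dx0 c' x := by ext <;> simp [K.Dx0, K.Dx1, K.xx1 c c']
  Dx1 c' x := by ext <;> simp [K.Dx0, K.Dx1, K.xx0 c c']
  xx0 c c' x := Prod.ext (K.xx0 _ _ _) (K.xx1 _ _ _)
  xx1 c c' x := Prod.ext (K.xx1 _ _ _) (K.xx0 _ _ _)

lemma Sys.cone_ell (K : Sys.{v, w} A g ϖ) (c : ι) (n : ℕ) :
    (K.cone c).ell n = K.ell (n + 1) - K.ell n := by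
  have h0 : Module.length A ((K.cone c).E0 ⧸ LinearMap.range ((K.cone c).e0 n)) =
    Module.length A (K.E0 ⧸ LinearMap.range (K.e0 (n + 1))) +
      Module.length A (K.E1 ⧸ LinearMap.range (K.e1 n)) :=
    length_coker_prodMap (K.e0 (n + 1)) (K.e1 n)
  have h1 : Module.length A ((K.cone c).E1 ⧸ LinearMap.range ((K.cone c).e1 n)) =
    Module.length A (K.E1 ⧸ LinearMap.range (K.e1 (n + 1))) +
      Module.length A (K.E0 ⧸ LinearMap.range (K.e0 n)) :=
    length_coker_prodMap (K.e1 (n + 1)) (K.e0 n)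
  unfold Sys.ell
  rw [h0, h1, ENat.toNat_add (K.cok0 _) (K.cok1 _), ENat.toNat_add (K.cok1 _) (K.cok0 _)]
  push_cast
  ring

lemma Sys.cone_kills (K : Sys.{v, w} A g ϖ) (c : ι) : (K.cone c).Kills (g c) := by
  constructor
  · rintro n ⟨α, β⟩ h
    have h1 : K.d0 (n + 1) α + K.s1 c n β = 0 := congrArg Prod.fst h
    refine ⟨(0, K.u0 c n α), ?_⟩
    refine Prod.ext ?_ ?_
    · show K.d1 (n + 1) 0 + K.s0 c n (K.u0 c n α) = g c • α
      rw [map_zero, zero_add, K.sug0]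
    · show - K.d0 n (K.u0 c n α) = g c • β
      rw [K.du0, eq_neg_of_add_eq_zero_left h1, map_neg, K.usg1, neg_neg]
  · rintro n ⟨α, β⟩ h
    have h1 : K.d1 (n + 1) α + K.s0 c n β = 0 := congrArg Prod.fst h
    refine ⟨(0, K.u1 c n α), ?_⟩
    refine Prod.ext ?_ ?_
    · show K.d0 (n + 1) 0 + K.s1 c n (K.u1 c n α) = g c • α
      rw [map_zero, zero_add, K.sug1]
    · show - K.d1 n (K.u1 c n α) = g c • β
      rw [K.du1, eq_neg_of_add_eq_zero_left h1, map_neg, K.usg0, neg_neg]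

lemma Sys.cone_kills' (K : Sys.{v, w} A g ϖ) (c : ι) (b : A) (hb : K.Kills b) :
    (K.cone c).Kills (b * b) := by
  constructor
  · rintro n ⟨α, β⟩ h
    have h1 : K.d0 (n + 1) α + K.s1 c n β = 0 := congrArg Prod.fst h
    have h2 : - K.d1 n β = 0 := congrArg Prod.snd h
    obtain ⟨y, hy⟩ := hb.2 n β (neg_eq_zero.1 h2)
    obtain ⟨x, hx⟩ := hb.1 (n + 1) (b • α + K.s0 c n y) (by
      rw [map_add, map_smul, K.ds0, hy, map_smul, ← smul_add, h1, smul_zero])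
    refine ⟨(x, - (b • y)), Prod.ext ?_ ?_⟩
    · show K.d1 (n + 1) x + K.s0 c n (- (b • y)) = (b * b) • α
      rw [hx, map_neg, map_smul, smul_add, mul_smul]; abel
    · show - K.d0 n (- (b • y)) = (b * b) • β
      rw [map_neg, neg_neg, map_smul, hy, mul_smul]
  · rintro n ⟨α, β⟩ h
    have h1 : K.d1 (n + 1) α + K.s0 c n β = 0 := congrArg Prod.fst h
    have h2 : - K.d0 n β = 0 := congrArg Prod.snd h
    obtain ⟨y, hy⟩ := hb.1 n β (neg_eq_zero.1 h2)
    obtain ⟨x, hx⟩ := hb.2 (n + 1) (b • α + K.s1 c n y) (by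
      rw [map_add, map_smul, K.ds1, hy, map_smul, ← smul_add, h1, smul_zero])
    refine ⟨(x, - (b • y)), Prod.ext ?_ ?_⟩
    · show K.d0 (n + 1) x + K.s1 c n (- (b • y)) = (b * b) • α
      rw [hx, map_neg, map_smul, smul_add, mul_smul]; abel
    · show - K.d1 n (- (b • y)) = (b * b) • β
      rw [map_neg, neg_neg, map_smul, hy, mul_smul]

lemma Sys.ell_const [IsNoetherianRing A]
    (hg : ∀ p : Ideal A, p.IsPrime → (∀ c, g c ∈ p) → p.IsMaximal) (r : ℕ) (hr : 0 < r)
    (T : List ι) : ∀ K : Sys.{v, w} A g ϖ, (∀ c, c ∉ T → ∃ m : ℕ, K.Kills (g c ^ m)) →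
      (∀ n, K.ell (n + r) = K.ell n) → ∀ n, K.ell n = K.ell 0 := by
  induction T with
  | nil =>
    intro K hK _ n
    rw [K.ell_eq hg (fun c => hK c (by simp)), K.ell_eq hg (fun c => hK c (by simp))]
  | cons c T ih =>
    intro K hK hp n
    have h := ih (K.cone c) (by
      intro c' hc'
      by_cases h : c' = c
      · subst h
        exact ⟨1, by rw [pow_one]; exact K.cone_kills _⟩
      · obtain ⟨m, hm⟩ := hK c' (by simp [h, hc'])
        exact ⟨m + m, by rw [pow_add]; exact K.cone_kills' _ _ hm⟩) (by
      intro n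
      rw [K.cone_ell, K.cone_ell, add_right_comm, hp, hp])
    simp only [K.cone_ell] at h
    have key : ∀ n : ℕ, K.ell n = K.ell 0 + n * (K.ell 1 - K.ell 0) := by
      intro n
      induction n with
      | zero => simp
      | succ n ihn =>
        have := h n
        simp only [zero_add] at this
        push_cast
        linarith
    have h0 := hp 0
    rw [zero_add, key r] at h0
    have : (r : ℤ) * (K.ell 1 - K.ell 0) = 0 := by linarith
    rcases mul_eq_zero.1 this with h' | h'
    · exact absurd h' (by exact_mod_cast hr.ne')
    · rw [key n, h']; simp

end Sys


section RingThm
open Function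

universe v

/-- the data of the descent problem in commutative algebra -/
structure DD (A S S2 S0 S02 : Type v) [CommRing A] [CommRing S] [CommRing S2] [CommRing S0]
    [CommRing S02] [Algebra A S] [Algebra A S2] [Algebra A S0] (ι : Type) where
  p : S →ₐ[A] S2
  q : S →ₐ[A] S2
  p0 : S0 →+* S02
  q0 : S0 →+* S02
  ρ : S →ₐ[A] S0
  ρ2 : S2 →+* S02
  hp : ∀ x, p0 (ρ x) = ρ2 (p x)
  hq : ∀ x, q0 (ρ x) = ρ2 (q x)
  ϖ : A
  τ : S2
  e : S0
  e' : S0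
  s : ι → S
  u : ι → S
  g : ι → A
  r : ℕ
  hr : 0 < r
  σ : S
  σ' : S
  H1 : ∀ m, p m = q m → ∃ a, algebraMap A S a = m
  H2 : ∀ m : S, ϖ • m = 0 → m = 0
  H2' : ∀ m : S2, ϖ • m = 0 → m = 0
  H3 : ∀ m : S, ρ m = 0 ↔ ∃ y, ϖ • y = m
  ee : e * e' = 1
  he : p0 e = ρ2 τ * q0 e
  he' : ρ2 τ * p0 e' = q0 e'
  H4 : ∀ α, p0 α = q0 α → ∃ a, algebraMap A S0 a = α
  hs : ∀ c, p (s c) = τ * q (s c)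
  hu : ∀ c, τ * p (u c) = q (u c)
  hus : ∀ c, u c * s c = algebraMap A S (g c)
  hσ : p σ = τ ^ r * q σ
  hσ' : τ ^ r * p σ' = q σ'
  σσ : σ * σ' = 1
  H7 : ∀ m : S, (∀ c, g c • m = 0) → m = 0
  H8 : ∀ P : Ideal A, P.IsPrime → (∀ c, g c ∈ P) → P.IsMaximal

namespace DD
variable {A S S2 S0 S02 : Type v} [CommRing A] [CommRing S] [CommRing S2] [CommRing S0]
    [CommRing S02] [Algebra A S] [Algebra A S2] [Algebra A S0] {ι : Type}
    (D : DD A S S2 S0 S02 ι)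

/-- the sections of the `n`-th power -/
def M (n : ℕ) : Submodule A S where
  carrier := {m | D.p m = D.τ ^ n * D.q m}
  add_mem' {a b} ha hb := by
    simp only [Set.mem_setOf_eq] at *
    rw [map_add, map_add, ha, hb, mul_add]
  zero_mem' := by simp
  smul_mem' a m hm := by
    simp only [Set.mem_setOf_eq] at *
    rw [map_smul, map_smul, hm, mul_smul_comm]

lemma mem_M {n : ℕ} {m : S} : m ∈ D.M n ↔ D.p m = D.τ ^ n * D.q m := Iff.rfl

/-- the image of `A` in `S0` -/
def E (_ : DD A S S2 S0 S02 ι) : Submodule A S0 := LinearMap.range (Algebra.linearMap A S0)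

lemma mem_E {α : S0} (h : D.p0 α = D.q0 α) : α ∈ D.E := by
  obtain ⟨a, ha⟩ := D.H4 α h
  exact ⟨a, ha⟩

lemma eps_mem (n : ℕ) (m : S) (hm : m ∈ D.M n) : D.ρ m * D.e' ^ n ∈ D.E := by
  apply D.mem_E
  rw [map_mul, map_mul, D.hp, D.hq, hm, map_mul, map_pow, map_pow, map_pow, ← D.he', mul_pow]
  ring

/-- reduction -/
def eps (n : ℕ) : D.M n →ₗ[A] D.E :=
  LinearMap.codRestrict D.E ((LinearMap.mulRight A (D.e' ^ n)) ∘ₗ D.ρ.toLinearMap ∘ₗ (D.M n).subtype)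
    (fun m => D.eps_mem n m m.2)

lemma eps_coe (n : ℕ) (m : D.M n) : (D.eps n m : S0) = D.ρ m * D.e' ^ n := rfl

lemma rho_eq_zero {n : ℕ} {m : S} (h : D.ρ m * D.e' ^ n = 0) : D.ρ m = 0 := by
  have : D.ρ m * D.e' ^ n * D.e ^ n = 0 := by rw [h, zero_mul]
  rwa [mul_assoc, ← mul_pow, mul_comm D.e', D.ee, one_pow, mul_one] at this

lemma ker_eps (n : ℕ) (m : D.M n) : D.eps n m = 0 ↔ ∃ y, D.ϖ • y = m := by
  constructor
  · intro h
    have h' : D.ρ m * D.e' ^ n = 0 := congrArg Subtype.val h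
    obtain ⟨y, hy⟩ := (D.H3 _).1 (D.rho_eq_zero h')
    refine ⟨⟨y, ?_⟩, Subtype.ext hy⟩
    rw [mem_M, ← sub_eq_zero]
    apply D.H2'
    rw [smul_sub, ← mul_smul_comm, ← map_smul, ← map_smul, hy, sub_eq_zero]
    exact m.2
  · rintro ⟨y, rfl⟩
    refine Subtype.ext ?_
    rw [eps_coe]
    have : D.ρ ((D.ϖ • y : D.M n) : S) = 0 := (D.H3 _).2 ⟨y, rfl⟩
    rw [this, zero_mul]; rfl

lemma mul_mem_M {n k : ℕ} {m m' : S} (hm : m ∈ D.M n) (hm' : m' ∈ D.M k) :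
    m * m' ∈ D.M (n + k) := by
  rw [mem_M] at *
  rw [map_mul, map_mul, hm, hm', pow_add]; ring

lemma s_mem (c : ι) : D.s c ∈ D.M 1 := by rw [mem_M, pow_one]; exact D.hs c

lemma pow_mem_M {n : ℕ} {m : S} (hm : m ∈ D.M 1) : m ^ n ∈ D.M n := by
  rw [mem_M] at *
  rw [map_pow, map_pow, hm, mul_pow, pow_one]

/-- multiplication by `s c` -/
def sM (c : ι) (n : ℕ) : D.M n →ₗ[A] D.M (n + 1) :=
  LinearMap.restrict (LinearMap.mulRight A (D.s c)) (fun _ hm => D.mul_mem_M hm (D.s_mem c))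

lemma u_mul_mem (c : ι) (n : ℕ) {m : S} (hm : m ∈ D.M (n + 1)) : m * D.u c ∈ D.M n := by
  rw [mem_M] at *
  rw [map_mul, map_mul, hm, ← D.hu, pow_succ]; ring

/-- multiplication by `u c` -/
def uM (c : ι) (n : ℕ) : D.M (n + 1) →ₗ[A] D.M n :=
  LinearMap.restrict (LinearMap.mulRight A (D.u c)) (fun _ hm => D.u_mul_mem c n hm)

lemma sM_coe (c n) (m : D.M n) : (D.sM c n m : S) = m * D.s c := rfl
lemma uM_coe (c n) (m : D.M (n + 1)) : (D.uM c n m : S) = m * D.u c := rfl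

lemma fin_M [IsNoetherianRing A] [Finite ι] (n : ℕ) : Module.Finite A (D.M n) := by
  induction n with
  | zero =>
    have hle : D.M 0 ≤ LinearMap.range (Algebra.linearMap A S) := by
      intro m hm
      rw [mem_M, pow_zero, one_mul] at hm
      obtain ⟨a, ha⟩ := D.H1 m hm
      exact ⟨a, ha⟩
    exact Module.Finite.of_injective (Submodule.inclusion hle) (Submodule.inclusion_injective _)
  | succ n ih =>
    refine Module.Finite.of_injective (LinearMap.pi fun c => D.uM c n) ?_
    rw [injective_iff_map_eq_zero]
    intro m hm
    refine Subtype.ext (D.H7 _ fun c => ?_)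
    have : (m : S) * D.u c = 0 := congrArg Subtype.val (congrFun hm c)
    rw [Algebra.smul_def, ← D.hus]
    linear_combination D.s c * this

lemma exists_xi (c : ι) : ∃ a, algebraMap A S0 a = D.ρ (D.s c) * D.e' := by
  have := D.eps_mem 1 _ (D.s_mem c)
  rwa [pow_one] at this

/-- coefficients of the `s c` -/
noncomputable def xi (c : ι) : A := (D.exists_xi c).choose
lemma xi_spec (c : ι) : algebraMap A S0 (D.xi c) = D.ρ (D.s c) * D.e' := (D.exists_xi c).choose_spec

lemma cok_fin [IsNoetherianRing A] (n : ℕ) :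
    Module.length A (D.E ⧸ LinearMap.range (D.eps n)) ≠ ⊤ := by
  have : Module.Finite A D.E := by unfold E; infer_instance
  refine length_ne_top_of_kill D.g D.H8 _ fun c => ⟨n, fun x => ?_⟩
  obtain ⟨⟨_, b, rfl⟩, rfl⟩ := Submodule.Quotient.mk_surjective _ x
  rw [← Submodule.Quotient.mk_smul, Submodule.Quotient.mk_eq_zero]
  obtain ⟨a, ha⟩ : ∃ a, algebraMap A S0 a = D.ρ (D.u c) * D.e := by
    apply D.H4
    rw [map_mul, map_mul, D.hp, D.hq, ← D.hu, D.he, map_mul]; ring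
  refine ⟨(a ^ n * b) • ⟨D.s c ^ n, D.pow_mem_M (D.s_mem c)⟩, Subtype.ext ?_⟩
  rw [map_smul]
  show (a ^ n * b) • (D.ρ (D.s c ^ n) * D.e' ^ n) = D.g c ^ n • algebraMap A S0 b
  have h1 : algebraMap A S0 (D.g c) = D.ρ (D.u c) * D.ρ (D.s c) := by
    rw [← map_mul, D.hus, AlgHom.commutes]
  rw [Algebra.smul_def, Algebra.smul_def, map_mul, map_pow, map_pow, map_pow, ha, h1]
  have := D.ee
  calc _ = (D.e * D.e') ^ n * ((D.ρ (D.u c) * D.ρ (D.s c)) ^ n * algebraMap A S0 b) := by ring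
    _ = _ := by rw [D.ee, one_pow, one_mul]

/-- multiplication by the image of `s c` -/
noncomputable def xE (c : ι) : D.E →ₗ[A] D.E := D.xi c • LinearMap.id

lemma xE_apply (c : ι) (α : D.E) : D.xE c α = D.xi c • α := rfl

lemma eps_sM (c : ι) (n : ℕ) (x : D.M n) : D.eps (n + 1) (D.sM c n x) = D.xE c (D.eps n x) := by
  refine Subtype.ext ?_
  rw [xE_apply, Submodule.coe_smul, eps_coe, eps_coe, sM_coe, Algebra.smul_def, D.xi_spec, map_mul]
  ring

/-- the initial system -/
noncomputable def sys [IsNoetherianRing A] [Finite ι] : Sys.{v, v} A D.g D.ϖ where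
  P0 n := D.M n
  P1 _ := PUnit
  E0 := D.E
  E1 := PUnit
  d0 _ := 0
  d1 _ := 0
  D0 := 0
  D1 := 0
  e0 := D.eps
  e1 _ := 0
  s0 := D.sM
  s1 _ _ := 0
  u0 := D.uM
  u1 _ _ := 0
  x0 := D.xE
  x1 _ := 0
  fin0 := D.fin_M
  fin1 _ := inferInstance
  dd0 _ _ := rfl
  dd1 _ _ := rfl
  DD0 _ := rfl
  DD1 _ := rfl
  De0 _ _ := rfl
  De1 _ _ := by simp
  inj0 n x h := Subtype.ext (D.H2 _ (congrArg Subtype.val h))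
  inj1 _ _ _ := rfl
  ker0 := D.ker_eps
  ker1 _ x := ⟨fun _ => ⟨0, rfl⟩, fun _ => rfl⟩
  cok0 := D.cok_fin
  cok1 n := by rw [Module.length_eq_zero]; simp
  ds0 _ _ _ := rfl
  ds1 _ _ _ := by simp
  du0 _ _ _ := rfl
  du1 _ _ _ := by simp
  ss0 c c' n x := Subtype.ext (by simp only [sM_coe]; ring)
  ss1 _ _ _ _ := rfl
  us0 c c' n x := Subtype.ext (by simp only [sM_coe, uM_coe]; ring)
  us1 _ _ _ _ := rfl
  usg0 c n x := Subtype.ext (by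
    simp only [sM_coe, uM_coe, Submodule.coe_smul, Algebra.smul_def, ← D.hus]; ring)
  usg1 _ _ _ := rfl
  sug0 c n x := Subtype.ext (by
    simp only [sM_coe, uM_coe, Submodule.coe_smul, Algebra.smul_def, ← D.hus]; ring)
  sug1 _ _ _ := rfl
  es0 := D.eps_sM
  es1 _ _ _ := rfl
  Dx0 _ _ := rfl
  Dx1 _ _ := by simp
  xx0 c c' x := by simp only [xE_apply]; exact smul_comm _ _ _
  xx1 _ _ _ := rfl

lemma exists_w : ∃ a, algebraMap A S0 a = D.ρ D.σ * D.e' ^ D.r := D.eps_mem D.r _ D.hσ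

lemma exists_w' : ∃ a, algebraMap A S0 a = D.ρ D.σ' * D.e ^ D.r := by
  apply D.H4
  rw [map_mul, map_mul, D.hp, D.hq, ← D.hσ', map_pow, map_pow, D.he, map_mul, map_pow]; ring

lemma σρ : D.ρ D.σ * D.ρ D.σ' = 1 := by rw [← map_mul, D.σσ, map_one]

lemma ww : (D.ρ D.σ' * D.e ^ D.r) * (D.ρ D.σ * D.e' ^ D.r) = 1 := by
  calc _ = (D.ρ D.σ * D.ρ D.σ') * (D.e * D.e') ^ D.r := by ring
    _ = 1 := by rw [D.σρ, D.ee]; simp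

lemma length_per (n : ℕ) : Module.length A (D.E ⧸ LinearMap.range (D.eps (n + D.r))) =
    Module.length A (D.E ⧸ LinearMap.range (D.eps n)) := by
  obtain ⟨a, ha⟩ := D.exists_w
  obtain ⟨b, hb⟩ := D.exists_w'
  have hba : ∀ α : D.E, b • a • α = α := by
    intro α
    refine Subtype.ext ?_
    show b • a • (α : S0) = α
    rw [Algebra.smul_def, Algebra.smul_def, ha, hb, ← mul_assoc, D.ww, one_mul]
  let φ : D.E ≃ₗ[A] D.E := LinearEquiv.ofLinear (a • LinearMap.id) (b • LinearMap.id)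
    (by ext1 α; exact (smul_comm a b α).trans (hba α)) (by ext1 α; exact hba α)
  refine (LinearEquiv.length_eq (Submodule.Quotient.equiv _ _ φ ?_)).symm
  ext α
  constructor
  · rintro ⟨_, ⟨m, rfl⟩, rfl⟩
    refine ⟨⟨(m : S) * D.σ, D.mul_mem_M m.2 D.hσ⟩, Subtype.ext ?_⟩
    show D.ρ ((m : S) * D.σ) * D.e' ^ (n + D.r) = a • (D.ρ m * D.e' ^ n)
    rw [Algebra.smul_def, ha, map_mul, pow_add]; ring
  · rintro ⟨m, rfl⟩
    have hm : (m : S) * D.σ' ∈ D.M n := by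
      have := m.2
      rw [mem_M] at *
      rw [map_mul, map_mul, this, ← D.hσ', pow_add]; ring
    refine ⟨D.eps n ⟨_, hm⟩, ⟨_, rfl⟩, Subtype.ext ?_⟩
    show a • (D.ρ ((m : S) * D.σ') * D.e' ^ n) = D.ρ m * D.e' ^ (n + D.r)
    rw [Algebra.smul_def, ha, map_mul, pow_add]
    linear_combination (D.ρ m * D.e' ^ n * D.e' ^ D.r) * D.σρ

theorem main [IsNoetherianRing A] [Finite ι] : ∃ s : S, D.p s = D.τ * D.q s ∧ D.ρ s = D.e ∧
    ∃ a b : A, s ^ D.r = algebraMap A S a * D.σ ∧ algebraMap A S0 (a * b) = 1 := by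
  have hl : ∀ n, D.sys.ell n =
      ((Module.length A (D.E ⧸ LinearMap.range (D.eps n))).toNat : ℤ) := by
    intro n
    have : Module.length A (D.sys.E1 ⧸ LinearMap.range (D.sys.e1 n)) = 0 := by
      have : Subsingleton D.sys.E1 := inferInstanceAs (Subsingleton PUnit.{v+1})
      exact Module.length_eq_zero
    unfold Sys.ell
    rw [this, ENat.toNat_zero, Nat.cast_zero, sub_zero]
    rfl
  cases nonempty_fintype ι
  have hc := Sys.ell_const D.H8 D.r D.hr (Finset.univ : Finset ι).toList D.sys
    (by intro c hc; simp at hc) (by intro n; rw [hl, hl, D.length_per]) 1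
  have h0 : LinearMap.range (D.eps 0) = ⊤ := by
    rw [LinearMap.range_eq_top]
    rintro ⟨_, a, rfl⟩
    refine ⟨⟨algebraMap A S a, ?_⟩, Subtype.ext ?_⟩
    · rw [mem_M, AlgHom.commutes, AlgHom.commutes]; simp
    · rw [eps_coe]; simp
  have h0' : Module.length A (D.E ⧸ LinearMap.range (D.eps 0)) = 0 := by
    rw [Module.length_eq_zero_iff, Submodule.Quotient.subsingleton_iff, h0]
  rw [hl, hl, h0'] at hc
  have h1 : Module.length A (D.E ⧸ LinearMap.range (D.eps 1)) = 0 := by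
    have := D.cok_fin 1
    lift Module.length A (D.E ⧸ LinearMap.range (D.eps 1)) to ℕ using this with l
    simpa using hc
  rw [Module.length_eq_zero_iff, Submodule.Quotient.subsingleton_iff,
    LinearMap.range_eq_top] at h1
  obtain ⟨⟨s, hs⟩, h⟩ := h1 ⟨1, 1, by simp⟩
  have h' : D.ρ s * D.e' ^ 1 = 1 := congrArg Subtype.val h
  have hρ : D.ρ s = D.e := by linear_combination D.e * h' - D.ρ s * D.ee
  refine ⟨s, by rwa [mem_M, pow_one] at hs, hρ, ?_⟩
  have hsr := D.pow_mem_M (n := D.r) hs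
  obtain ⟨a, ha⟩ := D.H1 (s ^ D.r * D.σ') (by
    rw [mem_M] at hsr
    rw [map_mul, map_mul, hsr, ← D.hσ']; ring)
  obtain ⟨b, hb⟩ := D.exists_w
  refine ⟨a, b, ?_, ?_⟩
  · rw [ha]; linear_combination - (s ^ D.r) * D.σσ
  · have := congrArg D.ρ ha
    rw [AlgHom.commutes, map_mul, map_pow, hρ] at this
    rw [map_mul, this, hb, mul_comm (D.e ^ _)]
    exact D.ww

end DD
end RingThm


section Basics

lemma resS_resS (X : Scheme.{u}) {U V W : X.Opens} (h1 : W ≤ V) (h2 : V ≤ U) (a : Γ(X, U)) :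
    resS X h1 (resS X h2 a) = resS X (h1.trans h2) a := by
  show (X.presheaf.map (homOfLE h1).op) ((X.presheaf.map (homOfLE h2).op) a) = _
  rw [← CategoryTheory.comp_apply, ← Functor.map_comp, ← op_comp, homOfLE_comp]
  rfl

lemma resS_self (X : Scheme.{u}) {U : X.Opens} (h : U ≤ U) (a : Γ(X, U)) :
    resS X h a = a := by
  show (X.presheaf.map (𝟙 (op U))) a = a
  simp

lemma coe_resU (X : Scheme.{u}) {U V : X.Opens} (h : V ≤ U) (a : (Γ(X, U))ˣ) :
    ((resU X h a : (Γ(X, V))ˣ) : Γ(X, V)) = resS X h (a : Γ(X, U)) := rfl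

/-- Pull back of sections. -/
def mapS {X Y : Scheme.{u}} (f : Y ⟶ X) {U : X.Opens} {W : Y.Opens} (e : W ≤ f ⁻¹ᵁ U) :
    Γ(X, U) →+* Γ(Y, W) := (f.appLE U W e).hom

lemma coe_mapU {X Y : Scheme.{u}} (f : Y ⟶ X) {U : X.Opens} {W : Y.Opens} (e : W ≤ f ⁻¹ᵁ U)
    (a : (Γ(X, U))ˣ) :
    ((LineBundleOn.mapU f e a : (Γ(Y, W))ˣ) : Γ(Y, W)) = mapS f e (a : Γ(X, U)) := rfl

lemma resS_mapS {X Y : Scheme.{u}} (f : Y ⟶ X) {U : X.Opens} {W W' : Y.Opens} (e : W ≤ f ⁻¹ᵁ U)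
    (h : W' ≤ W) (a : Γ(X, U)) :
    resS Y h (mapS f e a) = mapS f (h.trans e) a := by
  show (Y.presheaf.map (homOfLE h).op) ((f.appLE U W e) a) = (f.appLE U W' _) a
  rw [← CategoryTheory.comp_apply, Scheme.Hom.appLE_map]

lemma mapS_resS {X Y : Scheme.{u}} (f : Y ⟶ X) {U U' : X.Opens} {W : Y.Opens} (hU : U' ≤ U)
    (e : W ≤ f ⁻¹ᵁ U') (a : Γ(X, U)) :
    mapS f e (resS X hU a) = mapS f (e.trans (fun _ hx => hU hx)) a := by
  show (f.appLE U' W e) ((X.presheaf.map (homOfLE hU).op) a) = (f.appLE U W _) a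
  rw [← CategoryTheory.comp_apply, Scheme.Hom.map_appLE]

/-- Sections which agree locally agree. -/
lemma resS_ext (X : Scheme.{u}) {W : X.Opens} (a b : Γ(X, W))
    (h : ∀ x ∈ W, ∃ (B : X.Opens) (_ : x ∈ B) (hB : B ≤ W), resS X hB a = resS X hB b) :
    a = b := by
  choose B hx hB e using h
  refine TopCat.Sheaf.eq_of_locally_eq' X.sheaf (fun x : W => B x.1 x.2) W
    (fun x => homOfLE (hB x.1 x.2)) ?_ a b ?_
  · intro x hxW
    exact Opens.mem_iSup.2 ⟨⟨x, hxW⟩, hx x hxW⟩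
  · intro x
    exact e x.1 x.2

lemma resS_ext_cover (X : Scheme.{u}) {ι : Type*} {W : X.Opens} (C : ι → X.Opens)
    (hC : ∀ i, C i ≤ W) (hcov : ∀ x ∈ W, ∃ i, x ∈ C i) (a b : Γ(X, W))
    (h : ∀ i, resS X (hC i) a = resS X (hC i) b) : a = b := by
  apply resS_ext
  intro x hx
  obtain ⟨i, hi⟩ := hcov x hx
  exact ⟨C i, hi, hC i, h i⟩

lemma resS_glue (X : Scheme.{u}) {ι : Type u} {W : X.Opens} (C : ι → X.Opens)
    (hC : ∀ i, C i ≤ W) (hcov : ∀ x ∈ W, ∃ i, x ∈ C i) (s : ∀ i, Γ(X, C i))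
    (h : ∀ i j, resS X (inf_le_left : C i ⊓ C j ≤ C i) (s i) =
      resS X (inf_le_right : C i ⊓ C j ≤ C j) (s j)) :
    ∃ a : Γ(X, W), ∀ i, resS X (hC i) a = s i := by
  obtain ⟨a, ha, -⟩ := TopCat.Sheaf.existsUnique_gluing' X.sheaf C W
    (fun i => homOfLE (hC i)) (by
      intro x hx
      obtain ⟨i, hi⟩ := hcov x hx
      exact Opens.mem_iSup.2 ⟨i, hi⟩) s (fun i j => h i j)
  exact ⟨a, ha⟩

lemma isUnit_local (X : Scheme.{u}) {ι : Type u} {W : X.Opens} (C : ι → X.Opens)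
    (hC : ∀ i, C i ≤ W) (hcov : ∀ x ∈ W, ∃ i, x ∈ C i) (a : Γ(X, W))
    (h : ∀ i, IsUnit (resS X (hC i) a)) : IsUnit a := by
  choose v hv using fun i => (h i).exists_right_inv
  obtain ⟨b, hb⟩ := resS_glue X C hC hcov v (by
    intro i j
    have e1 := congrArg (resS X (inf_le_left : C i ⊓ C j ≤ C i)) (hv i)
    have e2 := congrArg (resS X (inf_le_right : C i ⊓ C j ≤ C j)) (hv j)
    rw [map_mul, map_one, resS_resS] at e1 e2
    exact left_inv_eq_right_inv (by rw [mul_comm]; exact e1) e2)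
  refine IsUnit.of_mul_eq_one b ?_
  refine resS_ext_cover X C hC hcov _ _ fun i => ?_
  rw [map_mul, map_one, hb, hv]

/-- Hartogs property for the open `V`. -/
def Hart (X : Scheme.{u}) (V : X.Opens) : Prop :=
  ∀ W : X.Opens, Function.Bijective (resS X (inf_le_left : W ⊓ V ≤ W))

lemma Hart.of_local (X : Scheme.{u}) (V : X.Opens)
    (hinj : ∀ (W : X.Opens) (a : Γ(X, W)), resS X (inf_le_left : W ⊓ V ≤ W) a = 0 →
      ∀ x ∈ W, x ∉ V → ∃ (B : X.Opens) (_ : x ∈ B) (hB : B ≤ W), resS X hB a = 0)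
    (hsurj : ∀ (W : X.Opens) (σ : Γ(X, W ⊓ V)), ∀ x ∈ W, x ∉ V →
      ∃ (B : X.Opens) (_ : x ∈ B) (hB : B ≤ W) (c : Γ(X, B)),
        resS X (inf_le_left : B ⊓ V ≤ B) c = resS X (inf_le_inf_right V hB) σ) :
    Hart X V := by
  have hi : ∀ W : X.Opens, Function.Injective (resS X (inf_le_left : W ⊓ V ≤ W)) := by
    intro W
    rw [injective_iff_map_eq_zero]
    intro a ha
    apply resS_ext
    intro x hx
    by_cases hxV : x ∈ V
    · exact ⟨W ⊓ V, ⟨hx, hxV⟩, inf_le_left, by rw [ha, map_zero]⟩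
    · obtain ⟨B, h1, h2, h3⟩ := hinj W a ha x hx hxV
      exact ⟨B, h1, h2, by rw [h3, map_zero]⟩
  refine fun W => ⟨hi W, fun σ => ?_⟩
  have key : ∀ x : W, ∃ (B : X.Opens) (_ : x.1 ∈ B) (hB : B ≤ W) (c : Γ(X, B)),
        resS X (inf_le_left : B ⊓ V ≤ B) c = resS X (inf_le_inf_right V hB) σ := by
    intro x
    by_cases hxV : x.1 ∈ V
    · refine ⟨W ⊓ V, ⟨x.2, hxV⟩, inf_le_left, σ, rfl⟩
    · exact hsurj W σ x.1 x.2 hxV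
  choose B hx hB c hc using key
  have hcov : ∀ x ∈ W, ∃ i, x ∈ B i := fun x hxW => ⟨⟨x, hxW⟩, hx ⟨x, hxW⟩⟩
  obtain ⟨a, ha⟩ := resS_glue X B hB hcov c (by
    intro i j
    apply hi
    have e1 := congrArg (resS X (inf_le_inf_right V inf_le_left : B i ⊓ B j ⊓ V ≤ B i ⊓ V)) (hc i)
    have e2 := congrArg (resS X (inf_le_inf_right V inf_le_right : B i ⊓ B j ⊓ V ≤ B j ⊓ V)) (hc j)
    simp only [resS_resS] at e1 e2 ⊢
    rw [e1, e2])
  refine ⟨a, ?_⟩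
  refine resS_ext_cover X (fun i => B i ⊓ V) (fun i => inf_le_inf_right V (hB i)) ?_ _ _ ?_
  · rintro x ⟨hxW, hxV⟩
    exact ⟨⟨x, hxW⟩, hx _, hxV⟩
  · intro i
    rw [← hc i, ← ha i]
    simp only [resS_resS]

end Basics


section Affine

lemma basicOpen_resS (X : Scheme.{u}) {U V : X.Opens} (h : V ≤ U) (a : Γ(X, U)) :
    X.basicOpen (resS X h a) = V ⊓ X.basicOpen a :=
  X.basicOpen_res a (homOfLE h).op

lemma isUnit_basicOpen (X : Scheme.{u}) {U W : X.Opens} (x : Γ(X, U)) (h : W ≤ X.basicOpen x) :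
    IsUnit (resS X (h.trans (X.basicOpen_le x)) x) := by
  have := (RingedSpace.isUnit_res_basicOpen X.toRingedSpace x)
  have h2 : IsUnit (resS X (X.basicOpen_le x) x) := this
  have h3 := h2.map (resS X h)
  rwa [resS_resS] at h3

lemma zero_of_basicOpen (X : Scheme.{u}) {U : X.Opens} (hU : IsCompact (U : Set X))
    (a x : Γ(X, U)) (H : resS X (X.basicOpen_le x) a = 0) : ∃ n : ℕ, x ^ n * a = 0 :=
  exists_pow_mul_eq_zero_of_res_basicOpen_eq_zero_of_isCompact X hU a x H

lemma lift_of_basicOpen (X : Scheme.{u}) {B : X.Opens} (hB : IsAffineOpen B)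
    (x : Γ(X, B)) (σ : Γ(X, X.basicOpen x)) :
    ∃ (n : ℕ) (a : Γ(X, B)), resS X (X.basicOpen_le x) a =
      resS X (X.basicOpen_le x) x ^ n * σ := by
  obtain ⟨n, a, h⟩ := (hB.isLocalization_basicOpen x).surj x σ
  refine ⟨n, a, ?_⟩
  exact h.symm.trans (mul_comm _ _)

lemma ext_pow (X : Scheme.{u}) {B V : X.Opens} (hB : IsAffineOpen B)
    (hc : IsCompact ((B ⊓ V : X.Opens) : Set X))
    (x : Γ(X, B)) (hx : X.basicOpen x ≤ V) (σ : Γ(X, B ⊓ V)) :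
    ∃ (n : ℕ) (a : Γ(X, B)), resS X (inf_le_left : B ⊓ V ≤ B) a =
      resS X (inf_le_left : B ⊓ V ≤ B) x ^ n * σ := by
  have hle : X.basicOpen x ≤ B ⊓ V := le_inf (X.basicOpen_le x) hx
  obtain ⟨n, a, h⟩ := lift_of_basicOpen X hB x (resS X hle σ)
  obtain ⟨m, hm⟩ := zero_of_basicOpen X hc
    (resS X (inf_le_left : B ⊓ V ≤ B) a - resS X (inf_le_left : B ⊓ V ≤ B) x ^ n * σ)
    (resS X (inf_le_left : B ⊓ V ≤ B) x) (by
      have hle2 : X.basicOpen (resS X (inf_le_left : B ⊓ V ≤ B) x) ≤ X.basicOpen x := by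
        rw [basicOpen_resS]; exact inf_le_right
      have := congrArg (resS X hle2) h
      simp only [map_sub, map_mul, map_pow, resS_resS] at this ⊢
      rw [this, sub_self])
  refine ⟨m + n, x ^ m * a, ?_⟩
  rw [map_mul, map_pow]
  rw [mul_sub, sub_eq_zero] at hm
  rw [hm]; ring

lemma germ_resS (X : Scheme.{u}) {U V : X.Opens} (h : V ≤ U) (x : X) (hx : x ∈ V) (a : Γ(X, U)) :
    X.presheaf.germ V x hx (resS X h a) = X.presheaf.germ U x (h hx) a :=
  TopCat.Presheaf.germ_res_apply X.presheaf (homOfLE h) x hx a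

lemma germ_eq_local (X : Scheme.{u}) {U : X.Opens} (x : X) (hx : x ∈ U) (a b : Γ(X, U))
    (h : X.presheaf.germ U x hx a = X.presheaf.germ U x hx b) :
    ∃ (B : X.Opens) (_ : x ∈ B) (hB : B ≤ U), resS X hB a = resS X hB b := by
  obtain ⟨W, hxW, i1, i2, e⟩ := TopCat.Presheaf.germ_eq X.presheaf x hx hx a b h
  exact ⟨W, hxW, i1.le, e⟩

/-- an affine basis inside an open. -/
lemma exists_affine (X : Scheme.{u}) (x : X) (U : X.Opens) (hx : x ∈ U) :
    ∃ B : X.Opens, IsAffineOpen B ∧ x ∈ B ∧ B ≤ U := by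
  obtain ⟨_, ⟨B, hB, rfl⟩, h1, h2⟩ := X.isBasis_affineOpens.exists_subset_of_mem_open hx U.2
  exact ⟨B, hB, h1, h2⟩

lemma zero_of_unit_pow_mul {A : Type*} [CommRing A] {k a : A} (hk : IsUnit k) {n : ℕ}
    (h : k ^ n * a = 0) : a = 0 := by
  have := (hk.pow n).mul_right_eq_zero (b := a)
  exact this.1 h

lemma nzd_near (X : Scheme.{u}) [IsLocallyNoetherian X] {B : X.Opens} (hB : IsAffineOpen B)
    (z : X) (hz : z ∈ B) (x : Γ(X, B))
    (hx : ∀ a : X.presheaf.stalk z, X.presheaf.germ B z hz x * a = 0 → a = 0) :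
    ∃ (B' : X.Opens) (_ : z ∈ B') (hB' : B' ≤ B), IsAffineOpen B' ∧ ∀ (W : X.Opens) (hW : W ≤ B')
      (a : Γ(X, W)), resS X (hW.trans hB') x * a = 0 → a = 0 := by
  have : IsNoetherianRing Γ(X, B) := IsLocallyNoetherian.component_noetherian ⟨B, hB⟩
  let I : Ideal Γ(X, B) := LinearMap.ker (LinearMap.mulLeft Γ(X, B) x)
  obtain ⟨s, hs⟩ := (isNoetherianRing_iff_ideal_fg _).1 this I
  have hsmem : ∀ g ∈ s, x * g = 0 := by
    intro g hg
    have : g ∈ I := hs ▸ Ideal.subset_span hg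
    exact this
  have hloc : ∀ g ∈ s, ∃ (C : X.Opens) (_ : z ∈ C) (hC : C ≤ B), resS X hC g = 0 := by
    intro g hg
    have : X.presheaf.germ B z hz g = 0 := by
      apply hx
      rw [← map_mul, hsmem g hg, map_zero]
    obtain ⟨C, h1, h2, h3⟩ := germ_eq_local X z hz g 0 (by rw [this, map_zero])
    exact ⟨C, h1, h2, by rw [h3, map_zero]⟩
  have hC : ∃ (C : X.Opens) (_ : z ∈ C) (hC : C ≤ B), ∀ g ∈ s, resS X hC g = 0 := by
    clear hs hsmem
    classical
    induction s using Finset.induction_on with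
    | empty => exact ⟨B, hz, le_rfl, by simp⟩
    | insert g s _ ih =>
      obtain ⟨C1, h1, h2, h3⟩ := ih (fun g hg => hloc g (Finset.mem_insert_of_mem hg))
      obtain ⟨C2, k1, k2, k3⟩ := hloc g (Finset.mem_insert_self _ _)
      refine ⟨C1 ⊓ C2, ⟨h1, k1⟩, inf_le_left.trans h2, ?_⟩
      intro g' hg'
      rcases Finset.mem_insert.1 hg' with rfl | hg'
      · rw [← resS_resS X inf_le_right k2, k3, map_zero]
      · rw [← resS_resS X inf_le_left h2, h3 g' hg', map_zero]
  obtain ⟨C, hzC, hCB, hCs⟩ := hC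
  have hCI : ∀ g, x * g = 0 → resS X hCB g = 0 := by
    intro g hg
    have h1 : g ∈ I := hg
    rw [← hs] at h1
    have h2 : Ideal.span (s : Set Γ(X, B)) ≤ RingHom.ker (resS X hCB) :=
      Ideal.span_le.2 fun g hg => hCs g hg
    exact h2 h1
  obtain ⟨h, h1, h2⟩ := hB.exists_basicOpen_le ⟨z, hzC⟩ hz
  refine ⟨X.basicOpen h, h2, X.basicOpen_le h, hB.basicOpen h, ?_⟩
  intro W hW a ha
  refine resS_ext X a 0 fun y hy => ?_
  have hyB : y ∈ B := X.basicOpen_le h (hW hy)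
  obtain ⟨k, k1, k2⟩ := hB.exists_basicOpen_le ⟨y, hy⟩ hyB
  refine ⟨X.basicOpen k, k2, k1, ?_⟩
  rw [map_zero]
  obtain ⟨n, c, hc⟩ := lift_of_basicOpen X hB k (resS X k1 a)
  obtain ⟨m, hm⟩ := zero_of_basicOpen X hB.isCompact (x * c) k (by
    rw [map_mul, hc]
    have := congrArg (resS X k1) ha
    rw [map_mul, map_zero, resS_resS] at this
    linear_combination (resS X (X.basicOpen_le k) k) ^ n * this)
  have h4 := hCI (k ^ m * c) (by linear_combination hm)
  have h5 := congrArg (resS X (k1.trans (hW.trans h1))) h4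
  rw [map_zero, resS_resS, map_mul, hc, map_pow, ← mul_assoc, ← pow_add] at h5
  exact zero_of_unit_pow_mul (isUnit_basicOpen X k le_rfl) h5

end Affine


section HartDepth

lemma isCompact_of_le_affine (X : Scheme.{u}) [IsLocallyNoetherian X] {B W : X.Opens}
    (hB : IsAffineOpen B) (h : W ≤ B) : IsCompact (W : Set X) := by
  have : IsNoetherianRing Γ(X, B) := IsLocallyNoetherian.component_noetherian ⟨B, hB⟩
  have : NoetherianSpace (B : Set X) := noetherianSpace_of_isAffineOpen B hB
  have h1 : IsCompact ((Subtype.val : ↥(B : Set X) → X) ⁻¹' (W : Set X)) := NoetherianSpace.isCompact _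
  have h2 := h1.image continuous_subtype_val
  have h3 : (Subtype.val : ↥(B : Set X) → X) '' ((Subtype.val : ↥(B : Set X) → X) ⁻¹' (W : Set X)) = W := by
    ext x
    constructor
    · rintro ⟨y, hy, rfl⟩
      exact hy
    · intro hx
      exact ⟨⟨x, h hx⟩, hx, rfl⟩
  rwa [h3] at h2

lemma exists_germ (X : Scheme.{u}) (x : X) (s : X.presheaf.stalk x) :
    ∃ (U : X.Opens) (hx : x ∈ U) (a : Γ(X, U)), X.presheaf.germ U x hx a = s :=
  TopCat.Presheaf.exists_germ_eq X.presheaf s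

lemma nzd_pow {A : Type*} [CommRing A] {x : A} (hx : ∀ a, x * a = 0 → a = 0) (n : ℕ) (a : A)
    (h : x ^ n * a = 0) : a = 0 := by
  induction n with
  | zero => simpa using h
  | succ n ih => exact ih (hx _ (by linear_combination h))

lemma depth_two {A : Type u} [CommRing A] [IsLocalRing A] (h : DepthGE A 2) :
    ∃ x y : A, x ∈ IsLocalRing.maximalIdeal A ∧ y ∈ IsLocalRing.maximalIdeal A ∧
      (∀ a, x * a = 0 → a = 0) ∧
      (∀ (K N : ℕ) (a b : A), y ^ K * a = x ^ N * b → ∃ c, a = x ^ N * c) := by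
  obtain ⟨rs, hl, hm, hr⟩ := h
  obtain ⟨x, y, rfl⟩ := List.length_eq_two.1 hl
  rw [RingTheory.Sequence.isWeaklyRegular_cons_iff,
    RingTheory.Sequence.isWeaklyRegular_cons_iff] at hr
  obtain ⟨h1, h2, -⟩ := hr
  have hx : ∀ a, x * a = 0 → a = 0 := fun a ha => by
    have : x • a = x • 0 := by simpa using ha
    exact h1 this
  have hy : ∀ a b, y * a = x * b → ∃ c, a = x * c := by
    intro a b hab
    have h3 : y • (Submodule.Quotient.mk a : QuotSMulTop x A) =
        y • (Submodule.Quotient.mk 0 : QuotSMulTop x A) := by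
      rw [← Submodule.Quotient.mk_smul, ← Submodule.Quotient.mk_smul, Submodule.Quotient.eq]
      rw [smul_zero, sub_zero, smul_eq_mul, hab]
      exact Submodule.smul_mem_pointwise_smul b x ⊤ trivial
    have h4 := h2 h3
    rw [Submodule.Quotient.eq, sub_zero] at h4
    obtain ⟨c, -, hc⟩ := h4
    exact ⟨c, hc.symm⟩
  have hyK : ∀ (K : ℕ) (a b : A), y ^ K * a = x * b → ∃ c, a = x * c := by
    intro K
    induction K with
    | zero => intro a b h; exact ⟨b, by simpa using h⟩
    | succ K ih =>
      intro a b h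
      obtain ⟨c, hc⟩ := ih (y * a) b (by linear_combination h)
      exact hy a c hc
  refine ⟨x, y, hm x (by simp), hm y (by simp), hx, ?_⟩
  intro K N
  induction N with
  | zero => intro a b _; exact ⟨a, by simp⟩
  | succ N ih =>
    intro a b h
    obtain ⟨a', ha'⟩ := hyK K a (x ^ N * b) (by linear_combination h)
    obtain ⟨c, hc⟩ := ih a' b (by
      rw [← sub_eq_zero]
      apply hx
      rw [ha'] at h
      linear_combination h)
    exact ⟨c, by rw [ha', hc]; ring⟩

theorem hart_of_depth (Y : Scheme.{u}) [IsLocallyNoetherian Y] (V : Y.Opens)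
    (hV : ∀ z, z ∉ V → ∃ N : Y.Opens, z ∈ N ∧ ∀ y ∈ N, y ≠ z → y ∈ V)
    (hd : ∀ z, z ∉ V → DepthGE (Y.presheaf.stalk z) 2) : Hart Y V := by
  have setup : ∀ z, z ∉ V → ∀ W : Y.Opens, z ∈ W → ∃ (B : Y.Opens) (hzB : z ∈ B)
      (x y : Γ(Y, B)), B ≤ W ∧ IsAffineOpen B ∧ Y.basicOpen x ≤ V ∧ Y.basicOpen y ≤ V ∧
      (∀ (W' : Y.Opens) (hW : W' ≤ B) (a : Γ(Y, W')), resS Y hW x * a = 0 → a = 0) ∧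
      (∀ (K N : ℕ) (a b : Y.presheaf.stalk z),
        (Y.presheaf.germ B z hzB y) ^ K * a = (Y.presheaf.germ B z hzB x) ^ N * b →
        ∃ c, a = (Y.presheaf.germ B z hzB x) ^ N * c) := by
    intro z hz W hzW
    obtain ⟨N, hzN, hN⟩ := hV z hz
    obtain ⟨x', y', hxm, hym, hx, hxy⟩ := depth_two (hd z hz)
    obtain ⟨U1, hz1, x1, rfl⟩ := exists_germ Y z x'
    obtain ⟨U2, hz2, y1, rfl⟩ := exists_germ Y z y'
    obtain ⟨B, hBa, hzB, hBle⟩ := exists_affine Y z (W ⊓ N ⊓ (U1 ⊓ U2)) ⟨⟨hzW, hzN⟩, hz1, hz2⟩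
    have hB1 : B ≤ U1 := hBle.trans (inf_le_right.trans inf_le_left)
    have hB2 : B ≤ U2 := hBle.trans (inf_le_right.trans inf_le_right)
    obtain ⟨B', hzB', hB', hB'a, hnz⟩ := nzd_near Y hBa z hzB (resS Y hB1 x1) (by
      intro a ha
      rw [germ_resS] at ha
      exact hx a ha)
    have hBN : B' ≤ N := hB'.trans (hBle.trans (inf_le_left.trans inf_le_right))
    have aux : ∀ x : Γ(Y, B'), Y.presheaf.germ B' z hzB' x ∈ IsLocalRing.maximalIdeal _ →
        Y.basicOpen x ≤ V := by
      intro x hx p hp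
      by_cases hpz : p = z
      · subst hpz
        exact absurd ((Scheme.mem_basicOpen Y x p hzB').1 hp) hx
      · exact hN p (hBN (Y.basicOpen_le x hp)) hpz
    refine ⟨B', hzB', resS Y (hB'.trans hB1) x1, resS Y (hB'.trans hB2) y1,
      hB'.trans (hBle.trans (inf_le_left.trans inf_le_left)), hB'a, aux _ ?_, aux _ ?_, ?_, ?_⟩
    · rw [germ_resS]; exact hxm
    · rw [germ_resS]; exact hym
    · intro W' hW a ha
      refine hnz W' hW a ?_
      rw [resS_resS] at ha ⊢
      exact ha
    · intro K N a b
      rw [germ_resS, germ_resS]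
      exact hxy K N a b
  have hinj : ∀ (W : Y.Opens) (a : Γ(Y, W)), resS Y (inf_le_left : W ⊓ V ≤ W) a = 0 →
      ∀ x ∈ W, x ∉ V → ∃ (B : Y.Opens) (_ : x ∈ B) (hB : B ≤ W), resS Y hB a = 0 := by
    intro W a ha z hzW hzV
    obtain ⟨B, hzB, x, y, hBW, hBa, hxV, hyV, hnz, -⟩ := setup z hzV W hzW
    refine ⟨B, hzB, hBW, ?_⟩
    obtain ⟨n, hn⟩ := zero_of_basicOpen Y hBa.isCompact (resS Y hBW a) x (by
      have := congrArg (resS Y (le_inf ((Y.basicOpen_le x).trans hBW) hxV)) ha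
      rw [map_zero, resS_resS] at this
      rw [resS_resS, this])
    refine nzd_pow (x := x) (fun c hc => hnz B le_rfl c ?_) n _ hn
    rw [resS_self]; exact hc
  refine Hart.of_local Y V hinj ?_
  intro W σ z hzW hzV
  obtain ⟨B, hzB, x, y, hBW, hBa, hxV, hyV, hnz, hreg⟩ := setup z hzV W hzW
  have hcomp : IsCompact ((B ⊓ V : Y.Opens) : Set Y) := isCompact_of_le_affine Y hBa inf_le_left
  obtain ⟨n, a, ha⟩ := ext_pow Y hBa hcomp x hxV (resS Y (inf_le_inf_right V hBW) σ)
  obtain ⟨k, b, hb⟩ := ext_pow Y hBa hcomp y hyV (resS Y (inf_le_inf_right V hBW) σ)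
  obtain ⟨C, hzC, hCB, hC⟩ := hinj B (y ^ k * a - x ^ n * b) (by
    rw [map_sub, map_mul, map_mul, ha, hb, map_pow, map_pow]; ring) z hzB hzV
  have hg := congrArg (Y.presheaf.germ C z hzC) hC
  rw [germ_resS, map_zero, map_sub, map_mul, map_mul, map_pow, map_pow, sub_eq_zero] at hg
  obtain ⟨c', hc'⟩ := hreg k n _ _ hg
  obtain ⟨U1, hz1, c, rfl⟩ := exists_germ Y z c'
  obtain ⟨D, hzD, hD, e⟩ := germ_eq_local Y (U := B ⊓ U1) z (Opens.mem_inf.2 ⟨hzB, hz1⟩) (resS Y inf_le_left a)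
    (resS Y inf_le_left x ^ n * resS Y inf_le_right c) (by
      rw [map_mul, map_pow, germ_resS, germ_resS, germ_resS]; exact hc')
  have hDB : D ≤ B := hD.trans inf_le_left
  refine ⟨D, hzD, hDB.trans hBW, resS Y (hD.trans inf_le_right) c, ?_⟩
  rw [← sub_eq_zero]
  have e1 := congrArg (resS Y (inf_le_left : D ⊓ V ≤ D)) e
  have e2 := congrArg (resS Y (inf_le_inf_right V hDB)) ha
  simp only [map_mul, map_pow, resS_resS] at e1 e2 ⊢
  refine nzd_pow (fun c hc => hnz (D ⊓ V) (inf_le_left.trans hDB) c hc) n _ ?_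
  linear_combination e2 - e1

end HartDepth


section Fiber

lemma mapS_mapS {X Y Z : Scheme.{u}} (g : Z ⟶ Y) (f : Y ⟶ X) {U : X.Opens} {V : Y.Opens}
    {W : Z.Opens} (e1 : V ≤ f ⁻¹ᵁ U) (e2 : W ≤ g ⁻¹ᵁ V) (e3 : W ≤ (g ≫ f) ⁻¹ᵁ U) (a : Γ(X, U)) :
    mapS g e2 (mapS f e1 a) = mapS (g ≫ f) e3 a := by
  show (g.appLE V W e2) ((f.appLE U V e1) a) = (g ≫ f).appLE U W e3 a
  rw [← CategoryTheory.comp_apply, Scheme.Hom.appLE_comp_appLE]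

/-- Data of the inclusion of the Cartier divisor `ϖ = 0`. -/
structure Fib (X X0 : Scheme.{u}) (i : X0 ⟶ X) (ϖ : Γ(X, ⊤)) : Prop where
  nX : IsLocallyNoetherian X
  nX0 : IsLocallyNoetherian X0
  inj : Function.Injective i.base
  closed : IsClosedImmersion i
  nzd : ∀ (W : X.Opens) (a : Γ(X, W)), resS X le_top ϖ * a = 0 → a = 0
  surj : ∀ (B : X.Opens), IsAffineOpen B → ∀ b : Γ(X0, i ⁻¹ᵁ B),
    ∃ a : Γ(X, B), mapS i le_rfl a = b
  ker : ∀ (B : X.Opens), IsAffineOpen B → ∀ a : Γ(X, B), mapS i le_rfl a = 0 ↔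
    ∃ y : Γ(X, B), (resS X le_top ϖ : Γ(X, B)) * y = a

lemma nzd_of_flat {R : CommRingCat.{u}} [IsDomain R] (X : Scheme.{u}) (f : X ⟶ Spec R)
    (hflat : IsFlatMorphism f) (p : R) (hp : p ≠ 0) (W : X.Opens) (a : Γ(X, W))
    (h : resS X le_top (f.appTop ((Scheme.ΓSpecIso R).inv p)) * a = 0) : a = 0 := by
  refine resS_ext X a 0 fun x hx => ?_
  refine germ_eq_local X x hx a 0 ?_
  rw [map_zero]
  have h1 := congrArg (X.presheaf.germ W x hx) h
  rw [map_zero, map_mul, germ_resS] at h1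
  let : Algebra ↥((Spec R).presheaf.stalk (f.base x)) ↥(X.presheaf.stalk x) :=
      RingHom.toAlgebra (f.stalkMap x).hom
  have hfl : Module.Flat ↥((Spec R).presheaf.stalk (f.base x)) ↥(X.presheaf.stalk x) := hflat x
  have h2 : X.presheaf.germ ⊤ x trivial (f.appTop ((Scheme.ΓSpecIso R).inv p)) =
      f.stalkMap x ((Spec R).presheaf.germ ⊤ (f.base x) trivial ((Scheme.ΓSpecIso R).inv p)) := by
    exact (Scheme.Hom.germ_stalkMap_apply f ⊤ x trivial _).symm
  rw [h2] at h1
  have h3 : (Spec R).presheaf.germ ⊤ (f.base x) trivial ((Scheme.ΓSpecIso R).inv p) ≠ 0 := by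
    intro h0
    have := germ_injective_of_isIntegral (X := Spec R) (f.base x) (U := ⊤) trivial
      (h0.trans (map_zero _).symm)
    have h5 := congrArg (Scheme.ΓSpecIso R).hom this
    rw [map_zero, ← CategoryTheory.comp_apply, Iso.inv_hom_id] at h5
    exact hp h5
  have h4 := Module.Flat.isSMulRegular_of_nonZeroDivisors
    (M := ↥(X.presheaf.stalk x)) (mem_nonZeroDivisors_of_ne_zero h3)
  apply h4
  show _ • _ = _ • (0 : ↥(X.presheaf.stalk x))
  rw [smul_zero]
  exact h1

lemma ker_of_pullback {R K : CommRingCat.{u}} (φ : R ⟶ K) (hφ : Function.Surjective φ) (p : R)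
    (hp : ∀ r, φ r = 0 ↔ ∃ s, p * s = r) (X : Scheme.{u}) (f : X ⟶ Spec R)
    (B : X.Opens) (hB : IsAffineOpen B) (a : Γ(X, B)) :
    mapS (Limits.pullback.fst f (Spec.map φ)) (le_refl (_ ⁻¹ᵁ B)) a = 0 ↔
      ∃ y, resS X le_top (f.appTop ((Scheme.ΓSpecIso R).inv p)) * y = a := by
  constructor
  · intro ha
    let w : Γ(X, B) := resS X le_top (f.appTop ((Scheme.ΓSpecIso R).inv p))
    let Q : CommRingCat.{u} := CommRingCat.of (Γ(X, B) ⧸ Ideal.span {w})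
    let q : Γ(X, B) ⟶ Q := CommRingCat.ofHom (Ideal.Quotient.mk _)
    let α : R ⟶ Γ(X, B) := (Scheme.ΓSpecIso R).inv ≫ f.appTop ≫
      X.presheaf.map (homOfLE (le_top : B ≤ ⊤)).op
    have hα : α p = w := rfl
    let g : {g : R →+* Q // RingHom.ker φ.hom ≤ RingHom.ker g} := ⟨(α ≫ q).hom, by
      intro r hr
      obtain ⟨s, rfl⟩ := (hp r).1 hr
      show q (α (p * s)) = 0
      rw [map_mul, map_mul, hα]
      have : q w = 0 := Ideal.Quotient.eq_zero_iff_mem.2 (Ideal.mem_span_singleton_self w)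
      rw [this, zero_mul]⟩
    let θ' : K →+* Q := RingHom.liftOfSurjective φ.hom hφ g
    have hθ : φ ≫ CommRingCat.ofHom θ' = α ≫ q := by
      ext r
      exact RingHom.liftOfRightInverse_comp_apply φ.hom _ (Function.rightInverse_surjInv hφ) g r
    have hf : hB.fromSpec ≫ f = Spec.map α := by
      have e1 : f = X.toSpecΓ ≫ Spec.map ((Scheme.ΓSpecIso R).inv ≫ f.appTop) := by
        rw [Spec.map_comp, ← Category.assoc, ← Scheme.toSpecΓ_naturality]
        simp
      rw [e1, IsAffineOpen.fromSpec_toSpecΓ_assoc, ← Spec.map_comp, Category.assoc]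
    have hw : (Spec.map q ≫ hB.fromSpec) ≫ f = Spec.map (CommRingCat.ofHom θ') ≫ Spec.map φ := by
      rw [Category.assoc, hf, ← Spec.map_comp, ← Spec.map_comp, hθ]
    let ψ := Limits.pullback.lift _ _ hw
    have hψ : ψ ≫ Limits.pullback.fst f (Spec.map φ) = Spec.map q ≫ hB.fromSpec :=
      Limits.pullback.lift_fst _ _ _
    have hle : (⊤ : (Spec Q).Opens) ≤ (Spec.map q ≫ hB.fromSpec) ⁻¹ᵁ B := by
      intro x _
      have := hB.fromSpec_preimage_self
      show (Spec.map q).base x ∈ hB.fromSpec ⁻¹ᵁ B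
      rw [this]; trivial
    have hle2 : (⊤ : (Spec Q).Opens) ≤ ψ ⁻¹ᵁ (Limits.pullback.fst f (Spec.map φ) ⁻¹ᵁ B) := by
      rw [← hψ] at hle
      exact hle
    have e0 : mapS (Spec.map q ≫ hB.fromSpec) hle a = 0 := by
      have e3 := mapS_mapS ψ (Limits.pullback.fst f (Spec.map φ)) (le_refl (_ ⁻¹ᵁ B)) hle2
        hle2 a
      rw [ha, map_zero] at e3
      have : ∀ (g : Spec Q ⟶ X) (_ : g = Spec.map q ≫ hB.fromSpec) (h : ⊤ ≤ g ⁻¹ᵁ B),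
          mapS g h a = 0 → mapS (Spec.map q ≫ hB.fromSpec) hle a = 0 := by
        rintro g rfl h h'
        exact h'
      exact this _ hψ _ e3.symm
    have e1 : (Spec.map q ≫ hB.fromSpec).appLE B ⊤ hle = q ≫ (Scheme.ΓSpecIso Q).inv := by
      have hle' : ⊤ ≤ Spec.map q ⁻¹ᵁ hB.fromSpec ⁻¹ᵁ B := hle
      have e6 : (Spec.map q ≫ hB.fromSpec).appLE B ⊤ hle =
          hB.fromSpec.app B ≫ (Spec.map q).appLE _ ⊤ hle' := Scheme.Hom.comp_appLE _ _ _ _ _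
      rw [e6, IsAffineOpen.fromSpec_app_self, Category.assoc,
        Scheme.Hom.map_appLE, Scheme.ΓSpecIso_inv_naturality]
      congr 1
    have e2 : q a = 0 := by
      have e4 : (q ≫ (Scheme.ΓSpecIso Q).inv) a = 0 := by
        rw [← e1]; exact e0
      have := congrArg (Scheme.ΓSpecIso Q).hom e4
      rw [map_zero, ← CategoryTheory.comp_apply, Category.assoc, Iso.inv_hom_id,
        Category.comp_id] at this
      exact this
    have e5 := Ideal.Quotient.eq_zero_iff_mem.1 e2
    obtain ⟨y, hy⟩ := Ideal.mem_span_singleton'.1 e5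
    exact ⟨y, by rw [← hy, mul_comm]⟩
  · rintro ⟨y, rfl⟩
    rw [map_mul, mapS_resS]
    suffices h : mapS (Limits.pullback.fst f (Spec.map φ)) (le_refl (_ ⁻¹ᵁ ⊤))
        (f.appTop ((Scheme.ΓSpecIso R).inv p)) = 0 by
      have h2 := congrArg (resS _ (show (Limits.pullback.fst f (Spec.map φ)) ⁻¹ᵁ B ≤
        (Limits.pullback.fst f (Spec.map φ)) ⁻¹ᵁ ⊤ from le_top)) h
      rw [map_zero, resS_mapS] at h2
      rw [h2, zero_mul]
    have e1 : mapS (Limits.pullback.fst f (Spec.map φ)) (le_refl (_ ⁻¹ᵁ ⊤))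
        (f.appTop ((Scheme.ΓSpecIso R).inv p)) = ((Scheme.ΓSpecIso R).inv ≫
          (Limits.pullback.fst f (Spec.map φ) ≫ f).appTop) p := by
      rw [Scheme.Hom.comp_appTop, Scheme.Hom.appTop]
      show (Scheme.Hom.appLE _ _ _ _) _ = _
      rw [Scheme.Hom.appLE_eq_app]
      rfl
    rw [e1, Limits.pullback.condition, Scheme.Hom.comp_appTop, ← Category.assoc,
      ← Scheme.ΓSpecIso_inv_naturality]
    have : φ p = 0 := (hp p).2 ⟨1, mul_one p⟩
    show (Limits.pullback.snd f (Spec.map φ)).appTop ((Scheme.ΓSpecIso K).inv (φ p)) = 0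
    rw [this, map_zero, map_zero]

end Fiber


section Fiber2

lemma fib_of_surj {R K : CommRingCat.{u}} [IsDomain R] [IsNoetherianRing R]
    (φ : R ⟶ K) (hφ : Function.Surjective φ) (p : R) (hp0 : p ≠ 0)
    (hp : ∀ r, φ r = 0 ↔ ∃ s, p * s = r) (X : Scheme.{u}) (f : X ⟶ Spec R)
    (hflat : IsFlatMorphism f) (hlft : LocallyOfFiniteType f) :
    Fib X (Limits.pullback f (Spec.map φ)) (Limits.pullback.fst f (Spec.map φ))
      (f.appTop ((Scheme.ΓSpecIso R).inv p)) := by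
  have hcl : IsClosedImmersion (Spec.map φ) := IsClosedImmersion.spec_of_surjective φ hφ
  have hcl2 : IsClosedImmersion (Limits.pullback.fst f (Spec.map φ)) := inferInstance
  have nX : IsLocallyNoetherian X := LocallyOfFiniteType.isLocallyNoetherian f
  refine ⟨nX, LocallyOfFiniteType.isLocallyNoetherian (Limits.pullback.fst f (Spec.map φ)),
    hcl2.isClosedEmbedding.injective, hcl2, ?_, ?_, ?_⟩
  · exact nzd_of_flat X f hflat p hp0
  · intro B hB b
    obtain ⟨a, ha⟩ := (Limits.pullback.fst f (Spec.map φ)).app_surjective B hB b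
    refine ⟨a, ?_⟩
    rw [← ha]
    show (Scheme.Hom.appLE _ _ _ _) _ = _
    rw [Scheme.Hom.appLE_eq_app]
  · intro B hB a
    exact ker_of_pullback φ hφ p hp X f B hB a

lemma fib_exists (R : Type u) [CommRing R] [IsDomain R] [IsDiscreteValuationRing R]
    (X : Scheme.{u}) (f : X ⟶ Spec (CommRingCat.of R))
    (hflat : IsFlatMorphism f) (hlft : LocallyOfFiniteType f) :
    ∃ ϖ, Fib X (Limits.pullback f ((Spec (CommRingCat.of R)).fromSpecResidueField
        (IsLocalRing.closedPoint R))) (Limits.pullback.fst f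
        ((Spec (CommRingCat.of R)).fromSpecResidueField (IsLocalRing.closedPoint R))) ϖ := by
  let x : PrimeSpectrum R := IsLocalRing.closedPoint R
  obtain ⟨p, hp⟩ := IsDiscreteValuationRing.exists_irreducible R
  have hm : x.asIdeal = Ideal.span {p} := hp.maximalIdeal_eq
  have hmax : x.asIdeal.IsMaximal := IsLocalRing.maximalIdeal.isMaximal R
  let φ := CommRingCat.ofHom (algebraMap R x.asIdeal.ResidueField) ≫
    (Scheme.Spec.residueFieldIso (CommRingCat.of R) x).inv
  have hφ : Spec.map φ = (Spec (CommRingCat.of R)).fromSpecResidueField x := by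
    rw [Spec.map_comp]
    exact Scheme.Spec.map_residueFieldIso_inv_eq_fromSpecResidueField (CommRingCat.of R) x
  have hinv : Function.Bijective (Scheme.Spec.residueFieldIso (CommRingCat.of R) x).inv :=
    ConcreteCategory.bijective_of_isIso _
  have hsurj : Function.Surjective φ := by
    intro y
    obtain ⟨y', rfl⟩ := hinv.2 y
    obtain ⟨r, hr⟩ := Ideal.algebraMap_residueField_surjective x.asIdeal y'
    exact ⟨r, congrArg (Scheme.Spec.residueFieldIso (CommRingCat.of R) x).inv hr⟩
  have hker : ∀ r : R, φ r = 0 ↔ ∃ s, p * s = r := by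
    intro r
    have h1 : φ r = 0 ↔ algebraMap R x.asIdeal.ResidueField r = 0 := by
      constructor
      · intro h
        exact hinv.1 (h.trans (map_zero _).symm)
      · intro h
        exact (congrArg (Scheme.Spec.residueFieldIso (CommRingCat.of R) x).inv h).trans (map_zero _)
    rw [h1, Ideal.algebraMap_residueField_eq_zero, hm, Ideal.mem_span_singleton]
    exact ⟨fun ⟨s, hs⟩ => ⟨s, hs.symm⟩, fun ⟨s, hs⟩ => ⟨s, hs.symm⟩⟩
  have key := fib_of_surj φ hsurj p hp.ne_zero hker X f hflat hlft
  have gen : ∀ (g : Spec ((Spec (CommRingCat.of R)).residueField x) ⟶ Spec (CommRingCat.of R)),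
      Spec.map φ = g → ∃ ϖ, Fib X (Limits.pullback f g) (Limits.pullback.fst f g) ϖ := by
    rintro g rfl
    exact ⟨_, key⟩
  exact gen _ hφ

end Fiber2


section HartX

variable {X X0 : Scheme.{u}} {i : X0 ⟶ X} {ϖ : Γ(X, ⊤)}

lemma Fib.map_pi (F : Fib X X0 i ϖ) {W : X0.Opens} (h : W ≤ i ⁻¹ᵁ ⊤) : mapS i h ϖ = 0 := by
  refine resS_ext X0 _ _ fun x hx => ?_
  obtain ⟨B, hBa, hxB, -⟩ := exists_affine X (i.base x) ⊤ trivial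
  have hx2 : x ∈ W ⊓ i ⁻¹ᵁ B := Opens.mem_inf.2 ⟨hx, hxB⟩
  refine ⟨W ⊓ i ⁻¹ᵁ B, hx2, inf_le_left, ?_⟩
  have h1 := (F.ker B hBa (resS X le_top ϖ)).2 ⟨1, mul_one _⟩
  have h2 := congrArg (resS X0 (inf_le_right : W ⊓ i ⁻¹ᵁ B ≤ i ⁻¹ᵁ B)) h1
  rw [mapS_resS, resS_mapS, map_zero] at h2
  rw [resS_mapS, map_zero]
  exact h2

lemma Fib.map_pi' (F : Fib X X0 i ϖ) {B : X.Opens} {W : X0.Opens} (h : W ≤ i ⁻¹ᵁ B) :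
    mapS i h (resS X le_top ϖ) = 0 := by
  rw [mapS_resS]
  exact F.map_pi _

lemma Fib.basicOpen_le (F : Fib X X0 i ϖ) (V : X.Opens)
    (hV : ∀ x, x ∉ V → x ∈ Set.range i.base) (B : X.Opens) :
    X.basicOpen (resS X (le_top : B ≤ ⊤) ϖ) ≤ V := by
  intro x hx
  by_contra hxV
  obtain ⟨y, rfl⟩ := hV x hxV
  rw [basicOpen_resS] at hx
  have h1 : y ∈ i ⁻¹ᵁ X.basicOpen ϖ := hx.2
  rw [Scheme.preimage_basicOpen] at h1
  have h2 : i.app ⊤ ϖ = 0 := by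
    rw [← Scheme.Hom.appLE_eq_app]
    exact F.map_pi _
  rw [h2, Scheme.basicOpen_zero] at h1
  exact h1

theorem Fib.hart (F : Fib X X0 i ϖ) (V : X.Opens)
    (hV : ∀ x, x ∉ V → x ∈ Set.range i.base) (h0 : Hart X0 (i ⁻¹ᵁ V)) : Hart X V := by
  have := F.nX
  refine Hart.of_local X V ?_ ?_
  · intro W a ha x hx hxV
    obtain ⟨B, hBa, hxB, hBW⟩ := exists_affine X x W hx
    refine ⟨B, hxB, hBW, ?_⟩
    obtain ⟨n, hn⟩ := zero_of_basicOpen X hBa.isCompact (resS X hBW a) (resS X le_top ϖ) (by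
      have := congrArg (resS X (le_inf ((X.basicOpen_le _).trans hBW)
        (F.basicOpen_le V hV B))) ha
      rw [map_zero, resS_resS] at this
      rw [resS_resS, this])
    exact nzd_pow (fun c hc => F.nzd B c hc) n _ hn
  · intro W σ x hx hxV
    obtain ⟨B, hBa, hxB, hBW⟩ := exists_affine X x W hx
    refine ⟨B, hxB, hBW, ?_⟩
    have hcomp : IsCompact ((B ⊓ V : X.Opens) : Set X) := isCompact_of_le_affine X hBa inf_le_left
    obtain ⟨n, a, ha⟩ := ext_pow X hBa hcomp (resS X le_top ϖ) (F.basicOpen_le V hV B)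
      (resS X (inf_le_inf_right V hBW) σ)
    rw [resS_resS] at ha
    induction n generalizing a with
    | zero => exact ⟨a, by simpa using ha⟩
    | succ n ih =>
      have h1 : mapS i (le_refl (i ⁻¹ᵁ B)) a = 0 := by
        apply (h0 (i ⁻¹ᵁ B)).1
        have h2 := congrArg (mapS i (LineBundleOn.preimage_inf_le i B V)) ha
        rw [mapS_resS, map_mul, map_pow, F.map_pi', zero_pow (Nat.succ_ne_zero n), zero_mul] at h2
        rw [resS_mapS, h2, map_zero]
      obtain ⟨y, rfl⟩ := (F.ker B hBa a).1 h1
      refine ih y ?_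
      rw [← sub_eq_zero]
      apply F.nzd
      rw [map_mul, resS_resS] at ha
      linear_combination ha

end HartX


section Isolated

lemma noeth_dim_zero {Y : Type*} [TopologicalSpace Y] [NoetherianSpace Y] [T0Space Y]
    (h : topologicalKrullDim Y ≤ 0) (z : Y) : IsOpen ({z} : Set Y) := by
  have hmin : ∀ C : IrreducibleCloseds Y, IsMin C :=
    Order.krullDim_nonpos_iff_forall_isMin.1 h
  have hcl : ∀ (C : Set Y), IsIrreducible C → IsClosed C → ∀ y ∈ C, closure {y} = C := by
    intro C h1 h2 y hy
    have hle : (closure {y} : Set Y) ⊆ C := closure_minimal (Set.singleton_subset_iff.2 hy) h2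
    refine hle.antisymm ?_
    exact hmin ⟨C, h1, h2⟩ (b := ⟨closure {y}, isIrreducible_singleton.closure, isClosed_closure⟩) hle
  let K : Set Y := ⋃ C ∈ {C ∈ irreducibleComponents Y | z ∉ C}, C
  have hK : IsClosed K := by
    refine Set.Finite.isClosed_biUnion ?_ ?_
    · exact (NoetherianSpace.finite_irreducibleComponents (α := Y)).subset fun C hC => hC.1
    · intro C hC
      exact isClosed_of_mem_irreducibleComponents C hC.1
  have : ({z} : Set Y) = Kᶜ := by
    ext y
    constructor
    · rintro rfl hy
      obtain ⟨C, hC, hy⟩ := Set.mem_iUnion₂.1 hy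
      exact hC.2 hy
    · intro hy
      have hz : z ∈ irreducibleComponent y := by
        by_contra hz
        exact hy (Set.mem_iUnion₂.2 ⟨irreducibleComponent y,
          ⟨irreducibleComponent_mem_irreducibleComponents y, hz⟩, mem_irreducibleComponent⟩)
      have e1 := hcl _ isIrreducible_irreducibleComponent isClosed_irreducibleComponent z hz
      have e2 := hcl _ isIrreducible_irreducibleComponent isClosed_irreducibleComponent y
        mem_irreducibleComponent
      exact ((inseparable_iff_closure_eq.2 (e2.trans e1.symm)).eq : y = z)
  rw [this]
  exact hK.isOpen_compl

lemma isolated (X : Scheme.{u}) [IsLocallyNoetherian X] (Z : Set X)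
    (hdim : topologicalKrullDim ↥Z ≤ 0) (V : X.Opens) (hV : (V : Set X) = Zᶜ) (z : X) (hz : z ∉ V) :
    ∃ N : X.Opens, z ∈ N ∧ ∀ y ∈ N, y ≠ z → y ∈ V := by
  have hmem : ∀ y, y ∉ V → y ∈ Z := by
    intro y hy
    by_contra h
    have : y ∈ (V : Set X) := by rw [hV]; exact h
    exact hy this
  obtain ⟨B, hB, hzB, -⟩ := exists_affine X z ⊤ trivial
  have : IsNoetherianRing Γ(X, B) := IsLocallyNoetherian.component_noetherian ⟨B, hB⟩
  have hN : NoetherianSpace (B : Set X) := noetherianSpace_of_isAffineOpen B hB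
  let Y : Set X := (B : Set X) ∩ Z
  have h1 : NoetherianSpace Y :=
    (Topology.IsEmbedding.inclusion (Set.inter_subset_left : Y ⊆ (B : Set X))).isInducing.noetherianSpace
  have h2 : topologicalKrullDim Y ≤ 0 :=
    (Topology.IsEmbedding.inclusion (Set.inter_subset_right : Y ⊆ Z)).isInducing.topologicalKrullDim_le.trans hdim
  have h3 := noeth_dim_zero h2 ⟨z, hzB, hmem z hz⟩
  obtain ⟨O, hO, e⟩ := isOpen_induced_iff.1 h3
  refine ⟨⟨O, hO⟩ ⊓ B, Opens.mem_inf.2 ⟨?_, hzB⟩, ?_⟩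
  · have : (⟨z, hzB, hmem z hz⟩ : Y) ∈ Subtype.val ⁻¹' O := by rw [e]; rfl
    exact this
  · intro y hy hne
    by_contra hyV
    obtain ⟨hy1, hy2⟩ := Opens.mem_inf.1 hy
    have : (⟨y, hy2, hmem y hyV⟩ : Y) ∈ Subtype.val ⁻¹' O := hy1
    rw [e] at this
    exact hne (congrArg Subtype.val this)

lemma Fib.isolated0 {X X0 : Scheme.{u}} {i : X0 ⟶ X} {ϖ : Γ(X, ⊤)} (F : Fib X X0 i ϖ) (V : X.Opens)
    (h : ∀ z, z ∉ V → ∃ N : X.Opens, z ∈ N ∧ ∀ y ∈ N, y ≠ z → y ∈ V) :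
    ∀ z, z ∉ i ⁻¹ᵁ V → ∃ N : X0.Opens, z ∈ N ∧ ∀ y ∈ N, y ≠ z → y ∈ i ⁻¹ᵁ V := by
  intro z hz
  obtain ⟨N, h1, h2⟩ := h (i.base z) hz
  exact ⟨i ⁻¹ᵁ N, h1, fun y hy hne => h2 _ hy (fun e => hne (F.inj e))⟩

end Isolated


section LB

variable {X : Scheme.{u}} {V : X.Opens}

/-- restricted transition functions -/
def tt (L : LineBundleOn X V) {W : X.Opens} (i j : L.ι) (hi : W ≤ L.U i) (hj : W ≤ L.U j) :
    Γ(X, W) := resS X (le_inf hi hj) (L.t i j : Γ(X, L.U i ⊓ L.U j))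

lemma resS_tt (L : LineBundleOn X V) {W W' : X.Opens} (h : W' ≤ W) (i j : L.ι) (hi : W ≤ L.U i)
    (hj : W ≤ L.U j) : resS X h (tt L i j hi hj) = tt L i j (h.trans hi) (h.trans hj) :=
  resS_resS X _ _ _

lemma tt_mul (L : LineBundleOn X V) {W : X.Opens} (i j k : L.ι) (hi : W ≤ L.U i) (hj : W ≤ L.U j)
    (hk : W ≤ L.U k) : tt L i j hi hj * tt L j k hj hk = tt L i k hi hk :=
  congrArg Units.val (L.cocycle_res i j k (le_inf (le_inf hi hj) hk) (le_inf hi hj) (le_inf hj hk)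
    (le_inf hi hk))

lemma isUnit_tt (L : LineBundleOn X V) {W : X.Opens} (i j : L.ι) (hi : W ≤ L.U i)
    (hj : W ≤ L.U j) : IsUnit (tt L i j hi hj) :=
  (L.t i j).isUnit.map (resS X (le_inf hi hj))

lemma tt_self (L : LineBundleOn X V) {W : X.Opens} (i : L.ι) (hi hi' : W ≤ L.U i) :
    tt L i i hi hi' = 1 := by
  have h := tt_mul L i i i hi hi hi
  exact (isUnit_tt L i i hi hi).mul_left_cancel (by rw [h, mul_one])

lemma tt_inv (L : LineBundleOn X V) {W : X.Opens} (i j : L.ι) (hi : W ≤ L.U i) (hj : W ≤ L.U j) :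
    tt L i j hi hj * tt L j i hj hi = 1 := by
  rw [tt_mul, tt_self]

lemma tt_pow (L : LineBundleOn X V) (r : ℕ) {W : X.Opens} (i j : L.ι) (hi : W ≤ L.U i)
    (hj : W ≤ L.U j) : tt (L.pow r) i j hi hj = tt L i j hi hj ^ r := by
  unfold tt
  rw [← map_pow]
  rfl

lemma compat_iff (L : LineBundleOn X V) (W : X.Opens) (s : ∀ i, Γ(X, W ⊓ L.U i)) :
    L.IsCompatFamily W s ↔ ∀ (W' : X.Opens) (h : W' ≤ W) (i j : L.ι) (hi : W' ≤ L.U i)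
      (hj : W' ≤ L.U j), resS X (le_inf h hi) (s i) = tt L i j hi hj * resS X (le_inf h hj) (s j) := by
  constructor
  · intro H W' h i j hi hj
    have h1 := congrArg (resS X (le_inf h (le_inf hi hj))) (H i j)
    rw [map_mul, resS_resS, resS_resS, coe_resU, resS_resS] at h1
    exact h1
  · intro H i j
    exact H _ inf_le_left i j (inf_le_right.trans inf_le_left) (inf_le_right.trans inf_le_right)

/-- a nowhere vanishing family -/
def UFam (L : LineBundleOn X V) (W : X.Opens) (g : ∀ i, Γ(X, W ⊓ L.U i)) : Prop :=
  L.IsCompatFamily W g ∧ ∀ i, IsUnit (g i)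

lemma gen_of_ufam (L : LineBundleOn X V) (hH : Hart X V) (W : X.Opens) (g : ∀ i, Γ(X, W ⊓ L.U i))
    (hg : UFam L W g) (W' : X.Opens) (hW' : W' ≤ W) (s : ∀ i, Γ(X, W' ⊓ L.U i))
    (hs : L.IsCompatFamily W' s) :
    ∃! a : Γ(X, W'), ∀ i, s i = resS X inf_le_left a * resS X (inf_le_inf hW' le_rfl) (g i) := by
  have hgu : ∀ i, IsUnit (resS X (inf_le_inf hW' (le_refl (L.U i))) (g i)) := fun i =>
    (hg.2 i).map _
  choose v hv using fun i => (hgu i).exists_right_inv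
  have hcov : ∀ x ∈ W' ⊓ V, ∃ i, x ∈ W' ⊓ L.U i := by
    intro x hx
    obtain ⟨h1, h2⟩ := Opens.mem_inf.1 hx
    obtain ⟨i, hi⟩ := L.covers x h2
    exact ⟨i, Opens.mem_inf.2 ⟨h1, hi⟩⟩
  have hC : ∀ i, W' ⊓ L.U i ≤ W' ⊓ V := fun i => inf_le_inf_left _ (L.le i)
  obtain ⟨b, hb⟩ := resS_glue X (fun i => W' ⊓ L.U i) hC hcov (fun i => s i * v i) (by
    intro i j
    have hle : (W' ⊓ L.U i) ⊓ (W' ⊓ L.U j) ≤ W' := inf_le_left.trans inf_le_left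
    have hi : (W' ⊓ L.U i) ⊓ (W' ⊓ L.U j) ≤ L.U i := inf_le_left.trans inf_le_right
    have hj : (W' ⊓ L.U i) ⊓ (W' ⊓ L.U j) ≤ L.U j := inf_le_right.trans inf_le_right
    have e1 := (compat_iff L W' s).1 hs _ hle i j hi hj
    have e2 := (compat_iff L W g).1 hg.1 _ (hle.trans hW') i j hi hj
    have e3 := congrArg (resS X (inf_le_left : (W' ⊓ L.U i) ⊓ (W' ⊓ L.U j) ≤ _)) (hv i)
    have e4 := congrArg (resS X (inf_le_right : (W' ⊓ L.U i) ⊓ (W' ⊓ L.U j) ≤ _)) (hv j)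
    rw [map_mul, map_one, resS_resS] at e3 e4
    rw [map_mul, map_mul, e1]
    rw [e2] at e3
    have hu := isUnit_tt L i j hi hj
    generalize resS X _ (g j) = G at *
    generalize resS X _ (s j) = S at *
    generalize resS X _ (v i) = A at *
    generalize resS X _ (v j) = B at *
    linear_combination S * B * e3 - tt L i j hi hj * S * A * e4)
  obtain ⟨a, ha⟩ := (hH W').2 b
  refine ⟨a, ?_, ?_⟩
  · intro i
    have h1 := hb i
    rw [← ha, resS_resS] at h1
    rw [h1]
    linear_combination - s i * hv i
  · intro a' ha'
    apply (hH W').1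
    refine resS_ext_cover X (fun i => W' ⊓ L.U i) hC hcov _ _ fun i => ?_
    rw [ha, hb, resS_resS, ha' i, mul_assoc, hv, mul_one]

lemma pushInv_iff (L : LineBundleOn X V) (hH : Hart X V) :
    L.PushforwardInvertible ↔ ∀ x : X, x ∉ V → ∃ (W : X.Opens) (_ : x ∈ W)
      (g : ∀ i, Γ(X, W ⊓ L.U i)), UFam L W g := by
  constructor
  · intro H x _
    obtain ⟨W, hx, g, hg, H⟩ := H x
    refine ⟨W, hx, g, hg, fun i => ?_⟩
    let s : ∀ j, Γ(X, (W ⊓ L.U i) ⊓ L.U j) := fun j =>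
      tt L j i inf_le_right (inf_le_left.trans inf_le_right)
    obtain ⟨a, ha, -⟩ := H (W ⊓ L.U i) inf_le_left s (by
      rw [compat_iff]
      intro W' h j k hj hk
      simp only [s]
      rw [resS_tt, resS_tt, tt_mul])
    have h1 := ha i
    simp only [s] at h1
    rw [tt_self] at h1
    have h2 := congrArg (resS X (le_inf le_rfl inf_le_right : W ⊓ L.U i ≤ (W ⊓ L.U i) ⊓ L.U i)) h1
    rw [map_one, map_mul, resS_resS, resS_resS, resS_self, resS_self] at h2
    exact IsUnit.of_mul_eq_one a (by rw [mul_comm]; exact h2.symm)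
  · intro H x
    have : ∃ (W : X.Opens) (_ : x ∈ W) (g : ∀ i, Γ(X, W ⊓ L.U i)), UFam L W g := by
      by_cases hx : x ∈ V
      · obtain ⟨i, hi⟩ := L.covers x hx
        refine ⟨L.U i, hi, fun j => tt L j i inf_le_right inf_le_left, ?_, fun j => isUnit_tt _ _ _ _ _⟩
        rw [compat_iff]
        intro W' h j k hj hk
        rw [resS_tt, resS_tt, tt_mul]
      · exact H x hx
    obtain ⟨W, hx, g, hg⟩ := this
    exact ⟨W, hx, g, hg.1, fun W' hW' s hs => gen_of_ufam L hH W g hg W' hW' s hs⟩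

lemma UFam.res {L : LineBundleOn X V} {W : X.Opens} {g : ∀ i, Γ(X, W ⊓ L.U i)} (hg : UFam L W g)
    {W' : X.Opens} (h : W' ≤ W) : UFam L W' (fun i => resS X (inf_le_inf_right _ h) (g i)) := by
  refine ⟨?_, fun i => (hg.2 i).map _⟩
  rw [compat_iff]
  intro W'' h'' i j hi hj
  rw [resS_resS, resS_resS]
  exact (compat_iff L W g).1 hg.1 _ (h''.trans h) i j hi hj

lemma tt_pullback {Y : Scheme.{u}} (f : Y ⟶ X) (L : LineBundleOn X V) {W : Y.Opens} {W1 : X.Opens}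
    (i j : L.ι) (hi : W ≤ f ⁻¹ᵁ L.U i) (hj : W ≤ f ⁻¹ᵁ L.U j) (h1 : W1 ≤ L.U i) (h2 : W1 ≤ L.U j)
    (hW : W ≤ f ⁻¹ᵁ W1) :
    tt (L.pullback f) i j hi hj = mapS f hW (tt L i j h1 h2) := by
  unfold tt
  rw [mapS_resS]
  exact resS_mapS f (LineBundleOn.preimage_inf_le f (L.U i) (L.U j)) (le_inf hi hj) _

lemma UFam.pullback {Y : Scheme.{u}} (f : Y ⟶ X) {L : LineBundleOn X V} {W : X.Opens}
    {g : ∀ i, Γ(X, W ⊓ L.U i)} (hg : UFam L W g) :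
    UFam (L.pullback f) (f ⁻¹ᵁ W) (fun i => mapS f (LineBundleOn.preimage_inf_le f W (L.U i)) (g i)) := by
  refine ⟨?_, fun i => (hg.2 i).map _⟩
  refine (compat_iff (L.pullback f) (f ⁻¹ᵁ W) _).2 ?_
  intro W' h i j hi hj
  have hle : W' ≤ f ⁻¹ᵁ (W ⊓ (L.U i ⊓ L.U j)) := fun x hx => ⟨h hx, hi hx, hj hx⟩
  have e := congrArg (mapS f hle) ((compat_iff L W g).1 hg.1 (W ⊓ (L.U i ⊓ L.U j)) inf_le_left i j
    (inf_le_right.trans inf_le_left) (inf_le_right.trans inf_le_right))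
  rw [map_mul, mapS_resS, mapS_resS] at e
  rw [tt_pullback f L i j hi hj (inf_le_right.trans inf_le_left) (inf_le_right.trans inf_le_right) hle]
  refine (resS_mapS f _ _ _).trans (e.trans ?_)
  congr 1
  exact (resS_mapS f _ _ _).symm

/-- Build a nowhere vanishing family from a family over a refined cover. -/
lemma ufam_of_cover (L : LineBundleOn X V) {κ : Type} {W : X.Opens} (C : κ → X.Opens)
    (c : κ → L.ι) (hCU : ∀ a, C a ≤ L.U (c a)) (hCW : ∀ a, C a ≤ W)
    (hcov : ∀ x ∈ W, x ∈ V → ∃ a, x ∈ C a) (s : ∀ a, Γ(X, C a)) (hs : ∀ a, IsUnit (s a))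
    (hc : ∀ a b, resS X (inf_le_left : C a ⊓ C b ≤ C a) (s a) =
      tt L (c a) (c b) (inf_le_left.trans (hCU a)) (inf_le_right.trans (hCU b)) *
        resS X (inf_le_right : C a ⊓ C b ≤ C b) (s b)) :
    ∃ g : ∀ i, Γ(X, W ⊓ L.U i), UFam L W g := by
  have hcov' : ∀ j, ∀ x ∈ W ⊓ L.U j, ∃ a : ULift.{u} κ, x ∈ L.U j ⊓ C a.down := by
    intro j x hx
    obtain ⟨h1, h2⟩ := Opens.mem_inf.1 hx
    obtain ⟨a, ha⟩ := hcov x h1 (L.le j h2)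
    exact ⟨⟨a⟩, Opens.mem_inf.2 ⟨h2, ha⟩⟩
  have hC : ∀ (j : L.ι) (a : ULift.{u} κ), L.U j ⊓ C a.down ≤ W ⊓ L.U j := fun j a =>
    le_inf (inf_le_right.trans (hCW _)) inf_le_left
  have hc' : ∀ (W' : X.Opens) (a b : κ) (ha : W' ≤ C a) (hb : W' ≤ C b), resS X ha (s a) =
      tt L (c a) (c b) (ha.trans (hCU a)) (hb.trans (hCU b)) * resS X hb (s b) := by
    intro W' a b ha hb
    have := congrArg (resS X (le_inf ha hb)) (hc a b)
    rw [map_mul, resS_tt, resS_resS, resS_resS] at this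
    exact this
  have key : ∀ j, ∃ g : Γ(X, W ⊓ L.U j), ∀ a : ULift.{u} κ, resS X (hC j a) g =
      tt L j (c a.down) inf_le_left (inf_le_right.trans (hCU _)) * resS X inf_le_right (s a.down) := by
    intro j
    refine resS_glue X (fun a : ULift.{u} κ => L.U j ⊓ C a.down) (hC j) (hcov' j) _ ?_
    intro a b
    rw [map_mul, map_mul, resS_tt, resS_tt, resS_resS, resS_resS,
      hc' _ a.down b.down (inf_le_left.trans inf_le_right) (inf_le_right.trans inf_le_right),
      ← mul_assoc, tt_mul]
  choose g hg using key
  refine ⟨g, ?_, ?_⟩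
  · rw [compat_iff]
    intro W' h i j hi hj
    refine resS_ext X _ _ fun x hx => ?_
    obtain ⟨a, ha⟩ := hcov x (h hx) (L.le i (hi hx))
    refine ⟨W' ⊓ C a, Opens.mem_inf.2 ⟨hx, ha⟩, inf_le_left, ?_⟩
    have hi' : W' ⊓ C a ≤ L.U i ⊓ C a := inf_le_inf_right _ hi
    have hj' : W' ⊓ C a ≤ L.U j ⊓ C a := inf_le_inf_right _ hj
    have e1 := congrArg (resS X hi') (hg i ⟨a⟩)
    have e2 := congrArg (resS X hj') (hg j ⟨a⟩)
    rw [map_mul, resS_tt, resS_resS, resS_resS] at e1 e2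
    rw [map_mul, resS_resS, resS_resS, resS_tt, e1, e2, ← mul_assoc, tt_mul]
  · intro j
    refine isUnit_local X (fun a : ULift.{u} κ => L.U j ⊓ C a.down) (hC j) (hcov' j) _ ?_
    intro a
    rw [hg]
    exact (isUnit_tt _ _ _ _ _).mul ((hs _).map _)

end LB


section Prep

lemma exists_unif {κ : Type*} [Finite κ] (Q : κ → ℕ → Prop) (hQ : ∀ a, ∃ n, ∀ m, n ≤ m → Q a m) :
    ∃ n, ∀ a, Q a n := by
  choose n hn using hQ
  obtain ⟨N, hN⟩ := (Set.finite_range n).bddAbove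
  exact ⟨N, fun a => hn a N (hN ⟨a, rfl⟩)⟩

lemma Hart.glue {Y : Scheme.{u}} {V : Y.Opens} (hH : Hart Y V) {B : Y.Opens} {κ : Type}
    (C : κ → Y.Opens) (hCB : ∀ a, C a ≤ B) (hCV : ∀ a, C a ≤ V)
    (hcov : ∀ x ∈ B, x ∈ V → ∃ a, x ∈ C a) (m : ∀ a, Γ(Y, C a))
    (hm : ∀ a b, resS Y (inf_le_left : C a ⊓ C b ≤ C a) (m a) =
      resS Y (inf_le_right : C a ⊓ C b ≤ C b) (m b)) :
    ∃ x : Γ(Y, B), ∀ a, resS Y (hCB a) x = m a := by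
  obtain ⟨y, hy⟩ := resS_glue Y (W := B ⊓ V) (fun a : ULift.{u} κ => C a.down)
    (fun a => le_inf (hCB _) (hCV _)) (by
      intro x hx
      obtain ⟨h1, h2⟩ := Opens.mem_inf.1 hx
      obtain ⟨a, ha⟩ := hcov x h1 h2
      exact ⟨⟨a⟩, ha⟩) (fun a => m a.down) (fun a b => hm _ _)
  obtain ⟨x, hx⟩ := (hH B).2 y
  refine ⟨x, fun a => ?_⟩
  rw [← hy ⟨a⟩, ← hx, resS_resS]

lemma Hart.ext_cover {Y : Scheme.{u}} {V : Y.Opens} (hH : Hart Y V) {B : Y.Opens} {κ : Type}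
    (C : κ → Y.Opens) (hCB : ∀ a, C a ≤ B) (hCV : ∀ a, C a ≤ V)
    (hcov : ∀ x ∈ B, x ∈ V → ∃ a, x ∈ C a) (x y : Γ(Y, B))
    (h : ∀ a, resS Y (hCB a) x = resS Y (hCB a) y) : x = y := by
  apply (hH B).1
  refine resS_ext_cover Y C (fun a => le_inf (hCB _) (hCV _)) ?_ _ _ fun a => ?_
  · intro x hx
    obtain ⟨h1, h2⟩ := Opens.mem_inf.1 hx
    exact hcov x h1 h2
  · rw [resS_resS, resS_resS]
    exact h a

lemma zero_of_basicOpen' (X : Scheme.{u}) {B U D : X.Opens} (hU : IsCompact (U : Set X))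
    (x : Γ(X, B)) (hUB : U ≤ B) (hD : D ≤ U) (hD' : U ⊓ X.basicOpen x ≤ D) (a : Γ(X, U))
    (H : resS X hD a = 0) : ∃ n : ℕ, ∀ m, n ≤ m → resS X hUB x ^ m * a = 0 := by
  have hle : X.basicOpen (resS X hUB x) ≤ D := by rw [basicOpen_resS]; exact hD'
  obtain ⟨n, hn⟩ := zero_of_basicOpen X hU a (resS X hUB x) (by
    have := congrArg (resS X hle) H
    rw [resS_resS, map_zero] at this
    exact this)
  refine ⟨n, fun m hm => ?_⟩
  obtain ⟨l, rfl⟩ := Nat.exists_eq_add_of_le hm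
  rw [pow_add]
  linear_combination resS X hUB x ^ l * hn

lemma lift_of_basicOpen' (X : Scheme.{u}) {B U D : X.Opens} (hU : IsAffineOpen U)
    (x : Γ(X, B)) (hUB : U ≤ B) (hD : D ≤ U) (hD' : D = U ⊓ X.basicOpen x) (σ : Γ(X, D)) :
    ∃ n : ℕ, ∀ m, n ≤ m → ∃ a : Γ(X, U), resS X hD a = resS X (hD.trans hUB) x ^ m * σ := by
  have hle : X.basicOpen (resS X hUB x) ≤ D := by rw [basicOpen_resS, hD']
  have hle' : D ≤ X.basicOpen (resS X hUB x) := by rw [basicOpen_resS, hD']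
  obtain ⟨n, a, ha⟩ := lift_of_basicOpen X hU (resS X hUB x) (resS X hle σ)
  have h1 := congrArg (resS X hle') ha
  rw [resS_resS, map_mul, map_pow, resS_resS, resS_resS, resS_resS, resS_self] at h1
  refine ⟨n, fun m hm => ?_⟩
  obtain ⟨l, rfl⟩ := Nat.exists_eq_add_of_le hm
  refine ⟨resS X hUB x ^ l * a, ?_⟩
  rw [map_mul, map_pow, resS_resS, h1]
  ring

/-- Extension of a section of a line bundle from `D(x)`. -/
lemma ext_sections (X : Scheme.{u}) [IsLocallyNoetherian X] {B : X.Opens} (hB : IsAffineOpen B)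
    {κ : Type} [Finite κ] (h : κ → Γ(X, B)) (x : Γ(X, B))
    (T : ∀ a b, Γ(X, X.basicOpen (h a) ⊓ X.basicOpen (h b)))
    (v : ∀ a, Γ(X, X.basicOpen (h a) ⊓ X.basicOpen x))
    (hv : ∀ a b (W : X.Opens) (ha : W ≤ X.basicOpen (h a)) (hb : W ≤ X.basicOpen (h b))
      (hx : W ≤ X.basicOpen x), resS X (le_inf ha hx) (v a) =
        resS X (le_inf ha hb) (T a b) * resS X (le_inf hb hx) (v b)) :
    ∃ (N : ℕ) (s : ∀ a, Γ(X, X.basicOpen (h a))),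
      (∀ a, resS X inf_le_left (s a) =
        resS X (inf_le_left.trans (X.basicOpen_le (h a))) x ^ N * v a) ∧
      ∀ a b, resS X inf_le_left (s a) = T a b * resS X inf_le_right (s b) := by
  obtain ⟨n, hn⟩ := exists_unif _ fun a => lift_of_basicOpen' X (hB.basicOpen (h a)) x
    (X.basicOpen_le (h a)) inf_le_left rfl (v a)
  choose s' hs' using hn
  have hd : ∀ ab : κ × κ, ∃ m, ∀ l, m ≤ l →
      resS X (inf_le_left.trans (X.basicOpen_le (h ab.1))) x ^ l *
      (resS X (inf_le_left : X.basicOpen (h ab.1) ⊓ X.basicOpen (h ab.2) ≤ _) (s' ab.1) -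
      T ab.1 ab.2 * resS X inf_le_right (s' ab.2)) = 0 := by
    rintro ⟨a, b⟩
    refine zero_of_basicOpen' X (isCompact_of_le_affine X hB
      (inf_le_left.trans (X.basicOpen_le (h a)))) x _ inf_le_left le_rfl _ ?_
    have e := hv a b ((X.basicOpen (h a) ⊓ X.basicOpen (h b)) ⊓ X.basicOpen x)
      (inf_le_left.trans inf_le_left) (inf_le_left.trans inf_le_right) inf_le_right
    have e1 := congrArg (resS X (le_inf (inf_le_left.trans inf_le_left) inf_le_right :
      (X.basicOpen (h a) ⊓ X.basicOpen (h b)) ⊓ X.basicOpen x ≤ _)) (hs' a)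
    have e2 := congrArg (resS X (le_inf (inf_le_left.trans inf_le_right) inf_le_right :
      (X.basicOpen (h a) ⊓ X.basicOpen (h b)) ⊓ X.basicOpen x ≤ _)) (hs' b)
    rw [map_mul, map_pow, resS_resS, resS_resS] at e1 e2
    rw [map_sub, map_mul, resS_resS, resS_resS, e1, e2, e]
    ring
  obtain ⟨m, hm⟩ := exists_unif _ hd
  refine ⟨m + n, fun a => resS X (X.basicOpen_le (h a)) x ^ m * s' a, ?_, ?_⟩
  · intro a
    rw [map_mul, map_pow, resS_resS, hs']
    ring
  · intro a b
    have := hm (a, b)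
    rw [map_mul, map_mul, map_pow, map_pow, resS_resS, resS_resS]
    linear_combination this

lemma finite_cover (X : Scheme.{u}) {V B : X.Opens} (hB : IsAffineOpen B)
    (hc : IsCompact ((B ⊓ V : X.Opens) : Set X)) (L : LineBundleOn X V) :
    ∃ (k : ℕ) (h : Fin k → Γ(X, B)) (c : Fin k → L.ι), (∀ a, X.basicOpen (h a) ≤ L.U (c a)) ∧
      ∀ x ∈ B, x ∈ V → ∃ a, x ∈ X.basicOpen (h a) := by
  have key : ∀ x : ↥(B ⊓ V : X.Opens), ∃ (h : Γ(X, B)) (c : L.ι), X.basicOpen h ≤ L.U c ∧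
      x.1 ∈ X.basicOpen h := by
    rintro ⟨x, hx⟩
    obtain ⟨h1, h2⟩ := Opens.mem_inf.1 hx
    obtain ⟨c, hc⟩ := L.covers x h2
    obtain ⟨h, h3, h4⟩ := hB.exists_basicOpen_le ⟨x, hc⟩ h1
    exact ⟨h, c, h3, h4⟩
  choose h c h1 h2 using key
  obtain ⟨t, ht⟩ := hc.elim_finite_subcover (fun x => (X.basicOpen (h x) : Set X))
    (fun x => (X.basicOpen (h x)).2) (fun x hx => Set.mem_iUnion.2 ⟨⟨x, hx⟩, h2 _⟩)
  refine ⟨t.card, fun a => h (t.equivFin.symm a), fun a => c (t.equivFin.symm a), fun a => h1 _, ?_⟩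
  intro x hxB hxV
  obtain ⟨y, hy, hxy⟩ := Set.mem_iUnion₂.1 (ht (Opens.mem_inf.2 ⟨hxB, hxV⟩))
  refine ⟨t.equivFin ⟨y, hy⟩, ?_⟩
  simpa using hxy

lemma primes_max (X : Scheme.{u}) {V B : X.Opens} (hB : IsAffineOpen B) (z : X)
    (hiso : ∀ y ∈ B, y ≠ z → y ∈ V) {κ : Type} (h : κ → Γ(X, B))
    (hcov : ∀ x ∈ B, x ∈ V → ∃ a, x ∈ X.basicOpen (h a)) (P : Ideal Γ(X, B)) (hP : P.IsPrime)
    (hh : ∀ a, h a ∈ P) : P.IsMaximal := by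
  have key : ∀ (Q : Ideal Γ(X, B)) (hQ : Q.IsPrime), (∀ a, h a ∈ Q) →
      hB.fromSpec.base ⟨Q, hQ⟩ = z := by
    intro Q hQ hh
    have hmem : hB.fromSpec.base ⟨Q, hQ⟩ ∈ B := by
      have : hB.fromSpec.base ⟨Q, hQ⟩ ∈ Set.range hB.fromSpec.base := ⟨_, rfl⟩
      rw [hB.range_fromSpec] at this
      exact this
    by_contra hne
    obtain ⟨a, ha⟩ := hcov _ hmem (hiso _ hmem hne)
    have h1 : (⟨Q, hQ⟩ : PrimeSpectrum Γ(X, B)) ∈ hB.fromSpec ⁻¹ᵁ X.basicOpen (h a) := ha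
    rw [hB.fromSpec_preimage_basicOpen] at h1
    exact h1 (hh a)
  obtain ⟨M, hM, hPM⟩ := Ideal.exists_le_maximal P hP.ne_top
  have e := (key P hP hh).trans (key M hM.isPrime fun a => hPM (hh a)).symm
  have e2 := hB.fromSpec.isOpenEmbedding.injective e
  have e3 : P = M := congrArg PrimeSpectrum.asIdeal e2
  rw [e3]; exact hM

end Prep


section Sec

variable {X : Scheme.{u}} {V : X.Opens}

lemma exists_sec [IsLocallyNoetherian X] {B : X.Opens} (hB : IsAffineOpen B)
    (L : LineBundleOn X V) {k : ℕ} (h : Fin k → Γ(X, B)) (c : Fin k → L.ι)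
    (hU : ∀ a, X.basicOpen (h a) ≤ L.U (c a)) (d : Fin k) :
    ∃ (N : ℕ) (s v : ∀ a, Γ(X, X.basicOpen (h a))),
      (∀ a b, resS X inf_le_left (s a) = tt L (c a) (c b) (inf_le_left.trans (hU a))
        (inf_le_right.trans (hU b)) * resS X inf_le_right (s b)) ∧
      (∀ a b, tt L (c a) (c b) (inf_le_left.trans (hU a))
        (inf_le_right.trans (hU b)) * resS X inf_le_left (v a) = resS X inf_le_right (v b)) ∧
      ∀ a, v a * s a = resS X (X.basicOpen_le (h a)) (h d ^ N) := by
  obtain ⟨n, s, hs, hs'⟩ := ext_sections X hB h (h d)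
    (fun a b => tt L (c a) (c b) (inf_le_left.trans (hU a)) (inf_le_right.trans (hU b)))
    (fun a => tt L (c a) (c d) (inf_le_left.trans (hU a)) (inf_le_right.trans (hU d))) (by
      intro a b W ha hb hx
      rw [resS_tt, resS_tt, resS_tt, tt_mul])
  obtain ⟨m, v, hv, hv'⟩ := ext_sections X hB h (h d)
    (fun a b => tt L (c b) (c a) (inf_le_right.trans (hU b)) (inf_le_left.trans (hU a)))
    (fun a => tt L (c d) (c a) (inf_le_right.trans (hU d)) (inf_le_left.trans (hU a))) (by
      intro a b W ha hb hx
      rw [resS_tt, resS_tt, resS_tt, mul_comm, tt_mul])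
  obtain ⟨l, hl⟩ := exists_unif _ fun a => zero_of_basicOpen' X (isCompact_of_le_affine X hB
      (X.basicOpen_le (h a))) (h d) (X.basicOpen_le (h a))
      (inf_le_left : X.basicOpen (h a) ⊓ X.basicOpen (h d) ≤ _) le_rfl
      (v a * s a - resS X (X.basicOpen_le (h a)) (h d ^ (m + n))) (by
        rw [map_sub, map_mul, resS_resS, hs, hv, map_pow, pow_add]
        have := tt_inv L (W := X.basicOpen (h a) ⊓ X.basicOpen (h d)) (c a) (c d)
          (inf_le_left.trans (hU a)) (inf_le_right.trans (hU d))
        linear_combination resS X (inf_le_left.trans (X.basicOpen_le (h a))) (h d) ^ m *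
          resS X (inf_le_left.trans (X.basicOpen_le (h a))) (h d) ^ n * this)
  refine ⟨l + (m + n), s, fun a => resS X (X.basicOpen_le (h a)) (h d) ^ l * v a, hs', ?_, ?_⟩
  · intro a b
    have e := hv' a b
    have e2 := tt_inv L (W := X.basicOpen (h a) ⊓ X.basicOpen (h b)) (c a) (c b)
          (inf_le_left.trans (hU a)) (inf_le_right.trans (hU b))
    rw [map_mul, map_mul, map_pow, map_pow, resS_resS, resS_resS, e]
    linear_combination resS X (inf_le_right.trans (X.basicOpen_le (h b))) (h d) ^ l *
      resS X inf_le_right (v b) * e2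
  · intro a
    have e := hl a
    rw [pow_add, map_mul, map_pow]
    linear_combination e

end Sec


section Assemble

lemma cover_of_ufam {X : Scheme.{u}} {V : X.Opens} (L : LineBundleOn X V) {κ : Type} {W : X.Opens}
    (C : κ → X.Opens)
    (c : κ → L.ι) (hCU : ∀ a, C a ≤ L.U (c a)) (hCW : ∀ a, C a ≤ W)
    (g : ∀ i, Γ(X, W ⊓ L.U i)) (hg : UFam L W g) :
    ∃ s s' : ∀ a, Γ(X, C a), (∀ a, s a * s' a = 1) ∧
    (∀ a b, resS X (inf_le_left : C a ⊓ C b ≤ C a) (s a) =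
      tt L (c a) (c b) (inf_le_left.trans (hCU a)) (inf_le_right.trans (hCU b)) *
        resS X (inf_le_right : C a ⊓ C b ≤ C b) (s b)) ∧
    (∀ a b, tt L (c a) (c b) (inf_le_left.trans (hCU a)) (inf_le_right.trans (hCU b)) *
      resS X (inf_le_left : C a ⊓ C b ≤ C a) (s' a) =
        resS X (inf_le_right : C a ⊓ C b ≤ C b) (s' b)) := by
  choose g' hg' using fun i => (hg.2 i).exists_right_inv
  have h1 : ∀ a, resS X (le_inf (hCW a) (hCU a)) (g (c a)) *
      resS X (le_inf (hCW a) (hCU a)) (g' (c a)) = 1 := by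
    intro a
    rw [← map_mul, hg', map_one]
  have h2 : ∀ a b, resS X (inf_le_left : C a ⊓ C b ≤ C a)
      (resS X (le_inf (hCW a) (hCU a)) (g (c a))) =
      tt L (c a) (c b) (inf_le_left.trans (hCU a)) (inf_le_right.trans (hCU b)) *
        resS X (inf_le_right : C a ⊓ C b ≤ C b) (resS X (le_inf (hCW b) (hCU b)) (g (c b))) := by
    intro a b
    rw [resS_resS, resS_resS]
    exact (compat_iff L W g).1 hg.1 _ (inf_le_left.trans (hCW a)) _ _ _ _
  refine ⟨fun a => resS X (le_inf (hCW a) (hCU a)) (g (c a)),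
    fun a => resS X (le_inf (hCW a) (hCU a)) (g' (c a)), h1, h2, ?_⟩
  intro a b
  have e1 := congrArg (resS X (inf_le_left : C a ⊓ C b ≤ C a)) (h1 a)
  have e2 := congrArg (resS X (inf_le_right : C a ⊓ C b ≤ C b)) (h1 b)
  rw [map_mul, map_one] at e1 e2
  have e3 := h2 a b
  rw [e3] at e1
  generalize resS X (inf_le_left : C a ⊓ C b ≤ C a)
      (resS X (le_inf (hCW a) (hCU a)) (g' (c a))) = p at *
  generalize resS X (inf_le_right : C a ⊓ C b ≤ C b)
      (resS X (le_inf (hCW b) (hCU b)) (g' (c b))) = q at *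
  linear_combination q * e1 -
    tt L (c a) (c b) (inf_le_left.trans (hCU a)) (inf_le_right.trans (hCU b)) * p * e2

variable {X X0 : Scheme.{u}} {i : X0 ⟶ X} {ϖ : Γ(X, ⊤)}

theorem local_gen (F : Fib X X0 i ϖ) {V : X.Opens} (hH : Hart X V) (hH0 : Hart X0 (i ⁻¹ᵁ V))
    (L : LineBundleOn X V) (r : ℕ) (hr : 0 < r) (z0 : X0) {B : X.Opens} (hB : IsAffineOpen B)
    (hzB : i.base z0 ∈ B) (hiso : ∀ y ∈ B, y ≠ i.base z0 → y ∈ V)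
    (σ : ∀ j, Γ(X, B ⊓ (L.pow r).U j)) (hσ : UFam (L.pow r) B σ)
    (e : ∀ j, Γ(X0, i ⁻¹ᵁ B ⊓ (L.pullback i).U j)) (he : UFam (L.pullback i) (i ⁻¹ᵁ B) e) :
    ∃ (W : X.Opens) (_ : i.base z0 ∈ W) (g : ∀ j, Γ(X, W ⊓ L.U j)), UFam L W g := by
  have := F.nX
  have hnoeth : IsNoetherianRing Γ(X, B) := IsLocallyNoetherian.component_noetherian ⟨B, hB⟩
  obtain ⟨k, h, c, hU, hcov⟩ := finite_cover X hB
    (isCompact_of_le_affine X hB (inf_le_left : B ⊓ V ≤ B)) L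
  let C : Fin k → X.Opens := fun a => X.basicOpen (h a)
  have hCB : ∀ a, C a ≤ B := fun a => X.basicOpen_le (h a)
  have hCV : ∀ a, C a ≤ V := fun a => (hU a).trans (L.le _)
  have hCa : ∀ a, IsAffineOpen (C a) := fun a => hB.basicOpen (h a)
  let C0 : Fin k → X0.Opens := fun a => i ⁻¹ᵁ C a
  have hC0B : ∀ a, C0 a ≤ i ⁻¹ᵁ B := fun a x hx => hCB a hx
  have hC0V : ∀ a, C0 a ≤ i ⁻¹ᵁ V := fun a x hx => hCV a hx
  have hcov0 : ∀ x ∈ i ⁻¹ᵁ B, x ∈ i ⁻¹ᵁ V → ∃ a, x ∈ C0 a := fun x h1 h2 => hcov _ h1 h2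
  have hC02 : ∀ a b, C0 a ⊓ C0 b ≤ i ⁻¹ᵁ (C a ⊓ C b) := fun a b =>
    LineBundleOn.preimage_inf_le i _ _
  let T : ∀ a b, Γ(X, C a ⊓ C b) := fun a b =>
    tt L (c a) (c b) (inf_le_left.trans (hU a)) (inf_le_right.trans (hU b))
  obtain ⟨σ1, σ2, hσ1, hσ2, hσ3⟩ := cover_of_ufam (L.pow r) C c hU hCB σ hσ
  have hTr : ∀ a b, tt (L.pow r) (W := C a ⊓ C b) (c a) (c b) (inf_le_left.trans (hU a))
    (inf_le_right.trans (hU b)) = T a b ^ r := fun a b => tt_pow L r _ _ _ _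
  obtain ⟨e1, e2, he1, he2, he3⟩ := cover_of_ufam (L.pullback i) C0 c (fun a x hx => hU a hx) hC0B
    e he
  have hT0 : ∀ a b, tt (L.pullback i) (W := C0 a ⊓ C0 b) (c a) (c b)
      (inf_le_left.trans fun x hx => hU a hx) (inf_le_right.trans fun x hx => hU b hx) =
      mapS i (hC02 a b) (T a b) := fun a b => tt_pullback i L _ _ _ _ _ _ _
  choose N s v hs hv hvs using exists_sec hB L h c hU
  let S : Type u := ∀ a, Γ(X, C a)
  let S2 : Type u := ∀ ab : Fin k × Fin k, Γ(X, C ab.1 ⊓ C ab.2)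
  let S0 : Type u := ∀ a, Γ(X0, C0 a)
  let S02 : Type u := ∀ ab : Fin k × Fin k, Γ(X0, C0 ab.1 ⊓ C0 ab.2)
  let fS : Γ(X, B) →+* S := RingHom.pi fun a => resS X (hCB a)
  let fS2 : Γ(X, B) →+* S2 := RingHom.pi fun ab => resS X (inf_le_left.trans (hCB ab.1))
  let fS0 : Γ(X, B) →+* S0 := RingHom.pi fun a => mapS i (hC0B a)
  let _ : CommRing S := Pi.commRing
  let _ : CommRing S2 := Pi.commRing
  let _ : CommRing S0 := Pi.commRing
  let _ : CommRing S02 := Pi.commRing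
  let _ : Algebra Γ(X, B) S := fS.toAlgebra
  let _ : Algebra Γ(X, B) S2 := fS2.toAlgebra
  let _ : Algebra Γ(X, B) S0 := fS0.toAlgebra
  let D : DD Γ(X, B) S S2 S0 S02 (Fin k) :=
  { p := { toRingHom := (RingHom.pi fun ab => (resS X inf_le_left).comp (Pi.evalRingHom _ ab.1))
           commutes' := fun x => funext fun ab => resS_resS X _ _ x }
    q := { toRingHom := (RingHom.pi fun ab => (resS X inf_le_right).comp (Pi.evalRingHom _ ab.2))
           commutes' := fun x => funext fun ab => resS_resS X _ _ x }
    p0 := RingHom.pi fun ab => (resS X0 inf_le_left).comp (Pi.evalRingHom _ ab.1)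
    q0 := RingHom.pi fun ab => (resS X0 inf_le_right).comp (Pi.evalRingHom _ ab.2)
    ρ := { toRingHom := (RingHom.pi fun a => (mapS i (le_refl (i ⁻¹ᵁ C a))).comp (Pi.evalRingHom _ a))
           commutes' := fun x => funext fun a => mapS_resS i _ _ x }
    ρ2 := RingHom.pi fun ab => (mapS i (hC02 ab.1 ab.2)).comp (Pi.evalRingHom _ ab)
    hp := fun x => funext fun ab => (resS_mapS i _ _ _).trans (mapS_resS i _ _ _).symm
    hq := fun x => funext fun ab => (resS_mapS i _ _ _).trans (mapS_resS i _ _ _).symm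
    ϖ := resS X le_top ϖ
    τ := fun ab => T ab.1 ab.2
    e := e1
    e' := e2
    s := s
    u := v
    g := fun d => h d ^ N d
    r := r
    hr := hr
    σ := σ1
    σ' := σ2
    H1 := by
      intro m hm
      obtain ⟨x, hx⟩ := hH.glue C hCB hCV hcov m (fun a b => congrFun hm (a, b))
      exact ⟨x, funext hx⟩
    H2 := by
      intro m hm
      funext a
      refine F.nzd _ (m a) ?_
      have h1 : resS X (hCB a) (resS X le_top ϖ) * m a = 0 := congrFun hm a
      rwa [resS_resS] at h1
    H2' := by
      intro m hm
      funext ab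
      refine F.nzd _ (m ab) ?_
      have h1 : resS X (inf_le_left.trans (hCB ab.1)) (resS X le_top ϖ) * m ab = 0 := congrFun hm ab
      rwa [resS_resS] at h1
    H3 := by
      intro m
      constructor
      · intro hm
        choose y hy using fun a => (F.ker (C a) (hCa a) (m a)).1 (congrFun hm a)
        refine ⟨y, funext fun a => ?_⟩
        show resS X (hCB a) (resS X le_top ϖ) * y a = m a
        rw [resS_resS]
        exact hy a
      · rintro ⟨y, rfl⟩
        funext a
        refine (F.ker (C a) (hCa a) _).2 ⟨y a, ?_⟩
        show _ = resS X (hCB a) (resS X le_top ϖ) * y a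
        rw [resS_resS]
    ee := funext he1
    he := funext fun ab => (he2 ab.1 ab.2).trans (congrArg (· * _) (hT0 ab.1 ab.2))
    he' := funext fun ab => (congrArg (· * _) (hT0 ab.1 ab.2)).symm.trans (he3 ab.1 ab.2)
    H4 := by
      intro α hα
      obtain ⟨x, hx⟩ := hH0.glue C0 hC0B hC0V hcov0 α (fun a b => congrFun hα (a, b))
      obtain ⟨y, rfl⟩ := F.surj B hB x
      refine ⟨y, funext fun a => ?_⟩
      rw [← hx, resS_mapS]
      rfl
    hs := fun d => funext fun ab => hs d ab.1 ab.2
    hu := fun d => funext fun ab => hv d ab.1 ab.2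
    hus := fun d => funext fun a => hvs d a
    hσ := funext fun ab => (hσ2 ab.1 ab.2).trans (congrArg (· * _) (hTr ab.1 ab.2))
    hσ' := funext fun ab => (congrArg (· * _) (hTr ab.1 ab.2)).symm.trans (hσ3 ab.1 ab.2)
    σσ := funext hσ1
    H7 := by
      intro m hm
      funext a
      have h1 : resS X (hCB a) (h a ^ N a) * m a = 0 := congrFun (hm a) a
      rw [map_pow] at h1
      exact zero_of_unit_pow_mul (isUnit_basicOpen X (h a) le_rfl) h1
    H8 := by
      intro P hP hg
      exact primes_max X hB (i.base z0) hiso h hcov P hP fun a => hP.mem_of_pow_mem _ (hg a) }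
  obtain ⟨t, ht1, -, a, b, ht2, hab⟩ := D.main
  have hab' : mapS i (le_refl (i ⁻¹ᵁ B)) (a * b) = 1 := by
    refine hH0.ext_cover C0 hC0B hC0V hcov0 _ _ fun d => ?_
    rw [resS_mapS, map_one]
    exact congrFun hab d
  have hz : i.base z0 ∈ X.basicOpen a := by
    have h1 : IsUnit (i.app B a) := by
      rw [← Scheme.Hom.appLE_eq_app]
      rw [map_mul] at hab'
      exact IsUnit.of_mul_eq_one _ hab'
    have h2 : z0 ∈ i ⁻¹ᵁ X.basicOpen a := by
      rw [Scheme.preimage_basicOpen, Scheme.basicOpen_of_isUnit _ h1]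
      exact hzB
    exact h2
  obtain ⟨g, hg⟩ := ufam_of_cover L (W := X.basicOpen a) (fun d => C d ⊓ X.basicOpen a) c
    (fun d => inf_le_left.trans (hU d)) (fun d => inf_le_right) (by
      intro x hx hxV
      obtain ⟨d, hd⟩ := hcov x (X.basicOpen_le a hx) hxV
      exact ⟨d, Opens.mem_inf.2 ⟨hd, hx⟩⟩) (fun d => resS X inf_le_left (t d)) (by
      intro d
      have h1 : t d ^ r = resS X (hCB d) a * σ1 d := congrFun ht2 d
      have h2 := congrArg (resS X (inf_le_left : C d ⊓ X.basicOpen a ≤ C d)) h1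
      rw [map_pow, map_mul, resS_resS] at h2
      refine (isUnit_pow_iff hr.ne').1 ?_
      rw [h2]
      refine IsUnit.mul ?_ ((IsUnit.of_mul_eq_one _ (hσ1 d)).map _)
      exact isUnit_basicOpen X a inf_le_right) (by
      intro d d'
      have h1 : resS X inf_le_left (t d) = T d d' * resS X inf_le_right (t d') :=
        congrFun ht1 (d, d')
      have h2 := congrArg (resS X (inf_le_inf inf_le_left inf_le_left :
        (C d ⊓ X.basicOpen a) ⊓ (C d' ⊓ X.basicOpen a) ≤ C d ⊓ C d')) h1
      rw [map_mul, resS_resS, resS_resS, resS_tt] at h2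
      rw [resS_resS, resS_resS]
      exact h2)
  exact ⟨_, hz, g, hg⟩

end Assemble


section Final

theorem main_fib {X X0 : Scheme.{u}} {i : X0 ⟶ X} {ϖ : Γ(X, ⊤)} (F : Fib X X0 i ϖ)
    (Z0 : Set ↥X) (hZ0X0 : Z0 ⊆ Set.range i.base)
    (hZ0dim : topologicalKrullDim ↥Z0 ≤ 0)
    (hdepth : ∀ z : ↥X0, i.base z ∈ Z0 → DepthGE ↥(X0.presheaf.stalk z) 2)
    (V : X.Opens) (hV : (V : Set ↥X) = Z0ᶜ) (L : LineBundleOn X V) :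
    L.PushforwardInvertible ↔
      ((L.pullback i).PushforwardInvertible ∧
        ∃ r : ℕ, 0 < r ∧ (L.pow r).PushforwardInvertible) := by
  have := F.nX
  have := F.nX0
  have hmem : ∀ y, y ∉ V → y ∈ Z0 := by
    intro y hy
    by_contra h
    have : y ∈ (V : Set X) := by rw [hV]; exact h
    exact hy this
  have hiso := isolated X Z0 hZ0dim V hV
  have hH0 : Hart X0 (i ⁻¹ᵁ V) := hart_of_depth X0 (i ⁻¹ᵁ V) (F.isolated0 V hiso)
    (fun z hz => hdepth z (hmem _ hz))
  have hVr : ∀ x, x ∉ V → x ∈ Set.range i.base := fun x hx => hZ0X0 (hmem x hx)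
  have hH : Hart X V := F.hart V hVr hH0
  rw [pushInv_iff L hH, pushInv_iff (L.pullback i) hH0]
  constructor
  · intro H
    refine ⟨?_, 1, Nat.one_pos, ?_⟩
    · intro x hx
      obtain ⟨W, hxW, g, hg⟩ := H (i.base x) hx
      exact ⟨i ⁻¹ᵁ W, hxW, _, hg.pullback i⟩
    · rw [pushInv_iff (L.pow 1) hH]
      intro x hx
      obtain ⟨W, hxW, g, hg⟩ := H x hx
      refine ⟨W, hxW, g, ?_, hg.2⟩
      refine (compat_iff (L.pow 1) W g).2 ?_
      intro W' h j k hj hk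
      have e1 := (compat_iff L W g).1 hg.1 W' h j k hj hk
      have e2 : tt (L.pow 1) j k hj hk = tt L j k hj hk := (tt_pow L 1 j k hj hk).trans (pow_one _)
      exact e1.trans (congrArg (· * _) e2.symm)
  · rintro ⟨H0, r, hr, Hr⟩ x hx
    rw [pushInv_iff (L.pow r) hH] at Hr
    obtain ⟨z0, rfl⟩ := hVr x hx
    obtain ⟨W0, h0, e, he⟩ := H0 z0 hx
    obtain ⟨W1, h1, σ, hσ⟩ := Hr _ hx
    obtain ⟨N, hN, hNV⟩ := hiso _ hx
    obtain ⟨O, hO, hOW⟩ := F.closed.isClosedEmbedding.isInducing.isOpen_iff.1 W0.2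
    have hzO : i.base z0 ∈ O := by
      have : z0 ∈ i.base ⁻¹' O := by rw [hOW]; exact h0
      exact this
    obtain ⟨B, hB, hzB, hBle⟩ := exists_affine X (i.base z0) (W1 ⊓ N ⊓ ⟨O, hO⟩)
      (Opens.mem_inf.2 ⟨Opens.mem_inf.2 ⟨h1, hN⟩, hzO⟩)
    have hB1 : B ≤ W1 := hBle.trans (inf_le_left.trans inf_le_left)
    have hBN : B ≤ N := hBle.trans (inf_le_left.trans inf_le_right)
    have hB0 : i ⁻¹ᵁ B ≤ W0 := by
      intro y hy
      have : y ∈ i.base ⁻¹' O := (Opens.mem_inf.1 (hBle hy)).2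
      rw [hOW] at this
      exact this
    exact local_gen F hH hH0 L r hr z0 hB hzB (fun y hy => hNV y (hBN hy)) _ (hσ.res hB1) _
      (he.res hB0)

end Final


open LineBundleOn in
/-- Let `T` be the spectrum of a DVR with closed point `0`, `f : X ⟶ T` a flat morphism
of finite type with `S2` fibers, and `Z0` a `0`-dimensional closed subscheme of the
special fiber `X0` with `depth_{Z0} X0 ≥ 2`.  Let `L` be a line bundle on
`U = X \ Z0`.  Then `j_* L` is a locally free `O_X`-module iff `(j0)_* (L |_{U0})` is
a locally free `O_{X0}`-module and `j_* (L^{⊗ r})` is locally free for some `r > 0`. -/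
theorem stmt_17 (R : Type u) [CommRing R] [IsDomain R] [IsDiscreteValuationRing R]
    (X : Scheme.{u}) (f : X ⟶ Spec (CommRingCat.of R))
    (hflat : IsFlatMorphism f)
    (hqc : QuasiCompact f) (hlft : LocallyOfFiniteType f)
    (hS2 : ∀ t : ↥(Spec (CommRingCat.of R)),
      IsS2Scheme (Limits.pullback f ((Spec (CommRingCat.of R)).fromSpecResidueField t)))
    -- the special fiber `X0` and its inclusion `ι0` into `X`
    (X0 : Scheme.{u}) (hX0 : X0 = Limits.pullback f ((Spec (CommRingCat.of R)).fromSpecResidueField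
        (IsLocalRing.closedPoint R)))
    (iota0 : X0 ⟶ X)
    (hiota0 : iota0 = hX0 ▸ Limits.pullback.fst f ((Spec (CommRingCat.of R)).fromSpecResidueField
        (IsLocalRing.closedPoint R)))
    -- `Z0` is a `0`-dimensional closed subset of `X0`, with `depth_{Z0} X0 ≥ 2`
    (Z0 : Set ↥X) (hZ0cl : IsClosed Z0) (hZ0X0 : Z0 ⊆ Set.range iota0.base)
    (hZ0dim : topologicalKrullDim ↥Z0 ≤ 0)
    (hdepth : ∀ z : ↥X0, iota0.base z ∈ Z0 → DepthGE ↥(X0.presheaf.stalk z) 2)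
    -- a line bundle `L` on `U = X \ Z0`
    (V : X.Opens) (hV : (V : Set ↥X) = Z0ᶜ)
    (L : LineBundleOn X V) :
    PushforwardInvertible L ↔
      (PushforwardInvertible (LineBundleOn.pullback iota0 L) ∧
        ∃ r : ℕ, 0 < r ∧ PushforwardInvertible (L.pow r)) := by
  subst hX0
  obtain ⟨ϖ, F⟩ := fib_exists R X f hflat hlft
  have F' : Fib X _ iota0 ϖ := by
    rw [hiota0]
    exact F
  exact main_fib F' Z0 hZ0X0 hZ0dim hdepth V hV L

end LocalPic
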